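/- arXiv:2510.04442 — 11 statements merged into one kernel-verified Lean document; each statement's English description precedes it below -/
import Mathlib

section
/- Let n ≥ 1 and let E = EuclideanSpace ℝ (Fin n) with its standard inner product ⟨·,·⟩, regarded as the (abelian) Lie algebra of the Lie group ℝⁿ with the Euclidean left-invariant metric; here the Levi-Civita connection vanishes, so for a symmetric trilinear form C on E with difference tensor K determined by ⟨K(X,Y),Z⟩ = −½·C(X,Y,Z), the corresponding left-invariant statistical structure (g,C) on ℝⁿ is dually flat if and only if the operators K_X := K(X,·) pairwise commute. Theorem: the operators K_X (X ∈ E) pairwise commute — equivalently, (g,C) is dually flat — if and only if there exist an orthonormal basis f₁,…,fₙ of E and real numbers λ₁,…,λₙ such that C(u,v,w) = Σᵢ λᵢ ⟨u,fᵢ⟩⟨v,fᵢ⟩⟨w,fᵢ⟩ for all u,v,w ∈ E (i.e., C = Σᵢ λᵢ xᵢ³ in the dual basis). -/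
open RealInnerProductSpace

/-- A commuting family of symmetric operators on a finite-dimensional inner product space admits
an orthonormal basis of joint eigenvectors. -/
theorem exists_orthonormalBasis_joint_eigenvectors {𝕜 E ι : Type*} [RCLike 𝕜]
    [NormedAddCommGroup E] [InnerProductSpace 𝕜 E] [FiniteDimensional 𝕜 E] {n : ℕ}
    (hn : Module.finrank 𝕜 E = n) (T : ι → E →ₗ[𝕜] E) (hT : ∀ i, (T i).IsSymmetric)
    (hcomm : Pairwise (Function.onFun Commute T)) :
    ∃ (f : OrthonormalBasis (Fin n) 𝕜 E) (a : Fin n → ι → 𝕜),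
      ∀ k i, T i (f k) = a k i • f k := by
  classical
  let V : (ι → 𝕜) → Submodule 𝕜 E := fun χ => ⨅ i, Module.End.eigenspace (T i) (χ i)
  have hV : OrthogonalFamily 𝕜 (fun χ => V χ) fun χ => (V χ).subtypeₗᵢ :=
    LinearMap.IsSymmetric.orthogonalFamily_iInf_eigenspaces hT
  have htop : ⨆ χ, V χ = ⊤ := LinearMap.IsSymmetric.iSup_iInf_eq_top_of_commute hT hcomm
  have hfin : Set.Finite {χ | V χ ≠ ⊥} :=
    WellFoundedGT.finite_ne_bot_of_iSupIndep hV.independent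
  let : Fintype {χ // V χ ≠ ⊥} := hfin.fintype
  have hW : OrthogonalFamily 𝕜 (fun χ : {χ // V χ ≠ ⊥} => V χ) fun χ => (V χ).subtypeₗᵢ :=
    hV.comp Subtype.val_injective
  have hint : DirectSum.IsInternal fun χ : {χ // V χ ≠ ⊥} => V χ := by
    rw [hW.isInternal_iff, iSup_ne_bot_subtype, htop, Submodule.top_orthogonal_eq_bot]
  refine ⟨hint.subordinateOrthonormalBasis hn hW,
    fun k => (hint.subordinateOrthonormalBasisIndex hn k hW).1, fun k i => ?_⟩
  have hk := hint.subordinateOrthonormalBasis_subordinate hn k hW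
  exact Module.End.mem_eigenspace_iff.mp (Submodule.mem_iInf _ |>.mp hk i)

/-- On the abelian Lie group `ℝⁿ` with the Euclidean left-invariant metric, a left-invariant
statistical structure `(g, C)` (with difference tensor `K` given by
`⟪K X Y, Z⟫ = -(1/2) C X Y Z`) is dually flat — equivalently the operators `K_X` pairwise
commute — if and only if `C = ∑ λᵢ xᵢ³` for some orthonormal basis. -/
theorem stmt_0 (n : ℕ) (hn : 1 ≤ n)
    (C : EuclideanSpace ℝ (Fin n) → EuclideanSpace ℝ (Fin n) → EuclideanSpace ℝ (Fin n) → ℝ)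
    (hC_add : ∀ u u' v w, C (u + u') v w = C u v w + C u' v w)
    (hC_smul : ∀ (r : ℝ) (u v w : EuclideanSpace ℝ (Fin n)), C (r • u) v w = r * C u v w)
    (hC_swap12 : ∀ u v w, C u v w = C v u w)
    (hC_swap23 : ∀ u v w, C u v w = C u w v)
    (K : EuclideanSpace ℝ (Fin n) → EuclideanSpace ℝ (Fin n) → EuclideanSpace ℝ (Fin n))
    (hK : ∀ X Y Z, ⟪K X Y, Z⟫ = -(1/2 : ℝ) * C X Y Z) :
    (∀ X Y Z, K X (K Y Z) = K Y (K X Z)) ↔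
      ∃ (f : OrthonormalBasis (Fin n) ℝ (EuclideanSpace ℝ (Fin n))) (lam : Fin n → ℝ),
        ∀ u v w, C u v w = ∑ i, lam i * (⟪u, f i⟫ * ⟪v, f i⟫ * ⟪w, f i⟫) := by
  constructor
  · intro hcomm
    have hCK : ∀ u v w, C u v w = -2 * ⟪K u v, w⟫ := fun u v w => by rw [hK]; ring
    let T : EuclideanSpace ℝ (Fin n) → EuclideanSpace ℝ (Fin n) →ₗ[ℝ] EuclideanSpace ℝ (Fin n) :=
      fun X =>
        { toFun := K X
          map_add' := fun Y Y' => ext_inner_right ℝ fun w => by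
            rw [inner_add_left, hK, hK, hK, hC_swap12, hC_add, hC_swap12 Y, hC_swap12 Y']
            ring
          map_smul' := fun r Y => ext_inner_right ℝ fun w => by
            rw [RingHom.id_apply, real_inner_smul_left, hK, hK, hC_swap12, hC_smul, hC_swap12 Y]
            ring }
    have hT : ∀ X, (T X).IsSymmetric := fun X Y Z => by
      change ⟪K X Y, Z⟫ = ⟪Y, K X Z⟫
      rw [real_inner_comm (K X Z), hK, hK, hC_swap23]
    obtain ⟨f, a, ha⟩ := exists_orthonormalBasis_joint_eigenvectors finrank_euclideanSpace_fin
      T hT fun X Y _ => LinearMap.ext (hcomm X Y)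
    have hCf : ∀ i u w, C u (f i) w = -2 * (a i u * ⟪w, f i⟫) := fun i u w => by
      rw [hCK, show K u (f i) = a i u • f i from ha i u, real_inner_smul_left, real_inner_comm]
    have haf : ∀ i u, a i u = a i (f i) * ⟪u, f i⟫ := fun i u => by
      have h : C u (f i) (f i) = C (f i) (f i) u := by rw [hC_swap12, hC_swap23]
      rw [hCf, hCf, real_inner_self_eq_norm_sq, f.orthonormal.1] at h
      linarith
    refine ⟨f, fun i => -2 * a i (f i), fun u v w => ?_⟩
    have hKv : K u v = ∑ i, ⟪f i, v⟫ • K u (f i) := by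
      change T u v = ∑ i, ⟪f i, v⟫ • T u (f i)
      conv_lhs => rw [← f.sum_repr' v]
      simp only [map_sum, map_smul]
    rw [hCK, hKv, sum_inner, Finset.mul_sum]
    refine Finset.sum_congr rfl fun i _ => ?_
    rw [real_inner_smul_left, mul_left_comm, ← hCK, hCf, haf i u, real_inner_comm]
    ring
  · rintro ⟨f, lam, hf⟩ X Y Z
    have hKf : ∀ X Y i, ⟪K X Y, f i⟫ = -(1/2 : ℝ) * (lam i * (⟪X, f i⟫ * ⟪Y, f i⟫)) := by
      intro X Y i
      rw [hK, hf, Finset.sum_eq_single i]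
      · rw [real_inner_self_eq_norm_sq, f.orthonormal.1]
        ring
      · intro j _ hj
        rw [f.orthonormal.2 hj.symm]
        ring
      · simp
    refine ext_inner_right ℝ fun w => ?_
    rw [hK, hK, hf, hf]
    congr 1
    refine Finset.sum_congr rfl fun i _ => ?_
    rw [hKf, hKf]
    ring
end

section
/- Let n ≥ 2 and let E = EuclideanSpace ℝ (Fin n) carry the hyperbolic Lie bracket and the Koszul connection ∇ as in the context. For a symmetric trilinear form C on E, the quadrilinear form ∇C is symmetric in all four of its arguments (i.e., (g,C) is conjugate symmetric) if and only if there exists α ∈ ℝ such that C = C^α. Moreover, for every α ∈ ℝ one has (∇C^α)(X,Y,Z,W) = −2α·(⟨X′,Y′⟩⟨Z′,W′⟩ + ⟨X′,Z′⟩⟨Y′,W′⟩ + ⟨X′,W′⟩⟨Y′,Z′⟩), where X′ denotes the orthogonal projection of X onto span(e₂,…,eₙ) (i.e., ∇C^α = −6α(Σ_{i≥2} xᵢ²)²). -/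
open RealInnerProductSpace Finset

/-- The inner product of the orthogonal projections to the span of all but the first basis
vector. -/
def horizontalInner {n : ℕ} (X Y : EuclideanSpace ℝ (Fin (n + 2))) : ℝ :=
  ∑ i ∈ univ.filter (fun i : Fin (n + 2) => i ≠ 0), X i * Y i

lemma horizontalInner_comm {n : ℕ} (X Y : EuclideanSpace ℝ (Fin (n + 2))) :
    horizontalInner X Y = horizontalInner Y X :=
  sum_congr rfl fun i _ => mul_comm (X i) (Y i)

lemma inner_eq_add_horizontalInner {n : ℕ} (X Y : EuclideanSpace ℝ (Fin (n + 2))) :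
    ⟪X, Y⟫ = X 0 * Y 0 + horizontalInner X Y := by
  rw [PiLp.inner_apply, horizontalInner, filter_ne',
    add_sum_erase _ (fun i => X i * Y i) (mem_univ _)]
  exact sum_congr rfl fun i _ => by simp [mul_comm]

/-- The first basis vector. -/
noncomputable def verticalVector (n : ℕ) : EuclideanSpace ℝ (Fin (n + 2)) :=
  EuclideanSpace.single 0 1

/-- The orthogonal projection to the span of all but the first basis vector. -/
noncomputable def horizontalPart {n : ℕ} (X : EuclideanSpace ℝ (Fin (n + 2))) :
    EuclideanSpace ℝ (Fin (n + 2)) :=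
  X - X 0 • verticalVector n

lemma verticalVector_apply {n : ℕ} (j : Fin (n + 2)) :
    verticalVector n j = if j = 0 then 1 else 0 := by
  simp [verticalVector]

lemma horizontalPart_apply {n : ℕ} (X : EuclideanSpace ℝ (Fin (n + 2))) (j : Fin (n + 2)) :
    horizontalPart X j = if j = 0 then 0 else X j := by
  by_cases h : j = 0 <;> simp [horizontalPart, verticalVector_apply, h]

lemma smul_verticalVector_add_horizontalPart {n : ℕ} (X : EuclideanSpace ℝ (Fin (n + 2))) :
    X 0 • verticalVector n + horizontalPart X = X := by
  simp [horizontalPart]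

lemma horizontalInner_horizontalPart {n : ℕ} (X Y : EuclideanSpace ℝ (Fin (n + 2))) :
    horizontalInner (horizontalPart X) (horizontalPart Y) = horizontalInner X Y :=
  sum_congr rfl fun i hi => by
    simp [horizontalPart_apply, (mem_filter.mp hi).2]

lemma horizontalInner_verticalVector {n : ℕ} (X : EuclideanSpace ℝ (Fin (n + 2))) :
    horizontalInner X (verticalVector n) = 0 :=
  sum_eq_zero fun i hi => by simp [verticalVector_apply, (mem_filter.mp hi).2]

/-- The Levi-Civita connection of the hyperbolic metric Lie algebra. -/
lemma koszul_connection_eq {n : ℕ}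
    {br nab : EuclideanSpace ℝ (Fin (n + 2)) → EuclideanSpace ℝ (Fin (n + 2)) →
      EuclideanSpace ℝ (Fin (n + 2))}
    (hbr : ∀ X Y (j : Fin (n + 2)), br X Y j =
      if j = 0 then 0 else X 0 * Y j - Y 0 * X j)
    (hnab : ∀ X Y Z, ⟪nab X Y, Z⟫ =
      (1/2 : ℝ) * (⟪br X Y, Z⟫ + ⟪br Z X, Y⟫ + ⟪X, br Z Y⟫))
    (X Y : EuclideanSpace ℝ (Fin (n + 2))) :
    nab X Y = horizontalInner X Y • verticalVector n - Y 0 • horizontalPart X := by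
  have hbr_inner (X Y Z : EuclideanSpace ℝ (Fin (n + 2))) :
      horizontalInner (br X Y) Z = X 0 * horizontalInner Y Z - Y 0 * horizontalInner X Z := by
    simp only [horizontalInner, mul_sum, ← sum_sub_distrib]
    refine sum_congr rfl fun i hi => ?_
    rw [hbr, if_neg (mem_filter.mp hi).2]
    ring
  have hinner (Z : EuclideanSpace ℝ (Fin (n + 2))) :
      ⟪nab X Y, Z⟫ = horizontalInner X Y * Z 0 - Y 0 * horizontalInner X Z := by
    rw [hnab]
    simp only [inner_eq_add_horizontalInner, hbr_inner, hbr X Y 0, hbr Z X 0, hbr Z Y 0,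
      horizontalInner_comm X (br Z Y), if_true]
    rw [horizontalInner_comm Z Y, horizontalInner_comm Y X, horizontalInner_comm Z X]
    ring
  refine ext_inner_right ℝ fun Z => ?_
  have hv : ⟪verticalVector n, Z⟫ = Z 0 := by
    simp [verticalVector, EuclideanSpace.inner_single_left]
  have hp : ⟪horizontalPart X, Z⟫ = horizontalInner X Z := by
    rw [horizontalPart, inner_sub_left, inner_smul_left, hv, inner_eq_add_horizontalInner]
    simp
  rw [hinner, inner_sub_left, inner_smul_left, inner_smul_left, hv, hp]
  simp

/-- A function of four arguments that is invariant under the adjacent transpositions is invariant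
under all permutations of its arguments. -/
lemma perm_four_invariant {α β : Type*} {f : α → α → α → α → β}
    (h01 : ∀ x y z w, f y x z w = f x y z w) (h12 : ∀ x y z w, f x z y w = f x y z w)
    (h23 : ∀ x y z w, f x y w z = f x y z w) (v : Fin 4 → α) (σ : Equiv.Perm (Fin 4)) :
    f (v (σ 0)) (v (σ 1)) (v (σ 2)) (v (σ 3)) = f (v 0) (v 1) (v 2) (v 3) := by
  have hσ : σ ∈ Submonoid.closure
      (Set.range fun i : Fin 3 => Equiv.swap i.castSucc i.succ) := by
    rw [Equiv.Perm.mclosure_swap_castSucc_succ]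
    exact Submonoid.mem_top σ
  induction hσ using Submonoid.closure_induction_right with
  | one => rfl
  | mul_right τ _ ρ hρ ih =>
    obtain ⟨i, rfl⟩ := hρ
    rw [← ih]
    fin_cases i
    · exact h01 _ _ _ _
    · exact h12 _ _ _ _
    · exact h23 _ _ _ _

/-- A symmetric trilinear form is determined by its restrictions to the vertical line and the
horizontal hyperplane. -/
lemma cubic_form_decomposition {n : ℕ}
    {C : EuclideanSpace ℝ (Fin (n + 2)) → EuclideanSpace ℝ (Fin (n + 2)) →
      EuclideanSpace ℝ (Fin (n + 2)) → ℝ}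
    (hC_add : ∀ u u' v w, C (u + u') v w = C u v w + C u' v w)
    (hC_smul : ∀ (r : ℝ) (u v w : EuclideanSpace ℝ (Fin (n + 2))), C (r • u) v w = r * C u v w)
    (hC_swap12 : ∀ u v w, C u v w = C v u w)
    (hC_swap23 : ∀ u v w, C u v w = C u w v)
    (u v w : EuclideanSpace ℝ (Fin (n + 2))) :
    C u v w =
      u 0 * v 0 * w 0 * C (verticalVector n) (verticalVector n) (verticalVector n) +
      (u 0 * v 0 * C (horizontalPart w) (verticalVector n) (verticalVector n) +
        u 0 * w 0 * C (horizontalPart v) (verticalVector n) (verticalVector n) +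
        v 0 * w 0 * C (horizontalPart u) (verticalVector n) (verticalVector n)) +
      (u 0 * C (horizontalPart v) (horizontalPart w) (verticalVector n) +
        v 0 * C (horizontalPart u) (horizontalPart w) (verticalVector n) +
        w 0 * C (horizontalPart u) (horizontalPart v) (verticalVector n)) +
      C (horizontalPart u) (horizontalPart v) (horizontalPart w) := by
  have h1 (u v w) : C u v w = u 0 * C (verticalVector n) v w + C (horizontalPart u) v w := by
    rw [← hC_smul, ← hC_add, smul_verticalVector_add_horizontalPart]
  have h2 (u v w) : C u v w = v 0 * C u (verticalVector n) w + C u (horizontalPart v) w := by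
    rw [hC_swap12 u v, h1, hC_swap12 _ u, hC_swap12 _ u]
  have h3 (u v w) : C u v w = w 0 * C u v (verticalVector n) + C u v (horizontalPart w) := by
    rw [hC_swap23 u v, h2, hC_swap23 u _ v, hC_swap23 u _ v]
  have s1 (x y) : C x (verticalVector n) y = C x y (verticalVector n) := hC_swap23 _ _ _
  have s2 (x y) : C (verticalVector n) x y = C x y (verticalVector n) := by
    rw [hC_swap12, hC_swap23]
  rw [h1 u, h2 _ v, h2 _ v, h3 _ _ w, h3 _ _ w, h3 _ _ w, h3 _ _ w,
    s1 _ (horizontalPart w), s1 _ (horizontalPart w), s2 (horizontalPart v) (horizontalPart w),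
    hC_swap12 (verticalVector n) (horizontalPart v),
    hC_swap12 (verticalVector n) (horizontalPart w)]
  ring

/-- On the Lie algebra `𝔤_{ℝHⁿ}` (bracket `[e₁,eᵢ] = eᵢ`, `i ≥ 2`) with the standard inner
product and its Levi-Civita (Koszul) connection `nab`, a left-invariant cubic form `C` is
conjugate symmetric (its covariant derivative `DC` is symmetric in all four arguments) iff
`C = C^α = α(4x₁³ + 6∑_{i≥2} x₁xᵢ²)` for some `α`; moreover
`∇C^α = -6α(∑_{i≥2} xᵢ²)²`. Here the dimension is `n + 2` (i.e. at least `2`). -/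
theorem stmt_1 (n : ℕ)
    (br nab : EuclideanSpace ℝ (Fin (n + 2)) → EuclideanSpace ℝ (Fin (n + 2)) →
      EuclideanSpace ℝ (Fin (n + 2)))
    (hbr : ∀ X Y (j : Fin (n + 2)), br X Y j =
      if j = 0 then 0 else X 0 * Y j - Y 0 * X j)
    (hnab : ∀ X Y Z, ⟪nab X Y, Z⟫ =
      (1/2 : ℝ) * (⟪br X Y, Z⟫ + ⟪br Z X, Y⟫ + ⟪X, br Z Y⟫))
    (C : EuclideanSpace ℝ (Fin (n + 2)) → EuclideanSpace ℝ (Fin (n + 2)) →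
      EuclideanSpace ℝ (Fin (n + 2)) → ℝ)
    (hC_add : ∀ u u' v w, C (u + u') v w = C u v w + C u' v w)
    (hC_smul : ∀ (r : ℝ) (u v w : EuclideanSpace ℝ (Fin (n + 2))), C (r • u) v w = r * C u v w)
    (hC_swap12 : ∀ u v w, C u v w = C v u w)
    (hC_swap23 : ∀ u v w, C u v w = C u w v)
    (DC : EuclideanSpace ℝ (Fin (n + 2)) → EuclideanSpace ℝ (Fin (n + 2)) →
      EuclideanSpace ℝ (Fin (n + 2)) → EuclideanSpace ℝ (Fin (n + 2)) → ℝ)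
    (hDC : ∀ X Y Z W, DC X Y Z W =
      -C (nab X Y) Z W - C Y (nab X Z) W - C Y Z (nab X W))
    (Ca : ℝ → EuclideanSpace ℝ (Fin (n + 2)) → EuclideanSpace ℝ (Fin (n + 2)) →
      EuclideanSpace ℝ (Fin (n + 2)) → ℝ)
    (hCa : ∀ α u v w, Ca α u v w =
      α * (4 * (u 0 * v 0 * w 0) +
        2 * ∑ i ∈ univ.filter (fun i : Fin (n + 2) => i ≠ 0),
          (u 0 * v i * w i + u i * v 0 * w i + u i * v i * w 0)))
    (DCa : ℝ → EuclideanSpace ℝ (Fin (n + 2)) → EuclideanSpace ℝ (Fin (n + 2)) →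
      EuclideanSpace ℝ (Fin (n + 2)) → EuclideanSpace ℝ (Fin (n + 2)) → ℝ)
    (hDCa : ∀ α X Y Z W, DCa α X Y Z W =
      -Ca α (nab X Y) Z W - Ca α Y (nab X Z) W - Ca α Y Z (nab X W)) :
    ((∀ (v : Fin 4 → EuclideanSpace ℝ (Fin (n + 2))) (σ : Equiv.Perm (Fin 4)),
        DC (v (σ 0)) (v (σ 1)) (v (σ 2)) (v (σ 3)) = DC (v 0) (v 1) (v 2) (v 3)) ↔
      ∃ α : ℝ, ∀ u v w, C u v w = Ca α u v w) ∧
    (∀ (α : ℝ) (X Y Z W : EuclideanSpace ℝ (Fin (n + 2))),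
      DCa α X Y Z W = -2 * α *
        ((∑ i ∈ univ.filter (fun i : Fin (n + 2) => i ≠ 0), X i * Y i) *
            (∑ i ∈ univ.filter (fun i : Fin (n + 2) => i ≠ 0), Z i * W i) +
          (∑ i ∈ univ.filter (fun i : Fin (n + 2) => i ≠ 0), X i * Z i) *
            (∑ i ∈ univ.filter (fun i : Fin (n + 2) => i ≠ 0), Y i * W i) +
          (∑ i ∈ univ.filter (fun i : Fin (n + 2) => i ≠ 0), X i * W i) *
            (∑ i ∈ univ.filter (fun i : Fin (n + 2) => i ≠ 0), Y i * Z i))) := by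
  have hnab' := koszul_connection_eq hbr hnab
  have hCa' (α : ℝ) (u v w : EuclideanSpace ℝ (Fin (n + 2))) :
      Ca α u v w = α * (4 * (u 0 * v 0 * w 0) + 2 * (u 0 * horizontalInner v w +
        v 0 * horizontalInner u w + w 0 * horizontalInner u v)) := by
    simp only [hCa, horizontalInner, mul_sum (a := u 0), mul_sum (a := v 0),
      mul_sum (a := w 0), ← sum_add_distrib]
    congr 3
    exact sum_congr rfl fun i _ => by ring
  have hnab_zero (X Y) : nab X Y 0 = horizontalInner X Y := by
    simp [hnab', verticalVector_apply, horizontalPart_apply]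
  have hnab_inner (X Y Z) : horizontalInner (nab X Y) Z = -(Y 0 * horizontalInner X Z) := by
    simp only [horizontalInner, mul_sum, ← sum_neg_distrib]
    refine sum_congr rfl fun i hi => ?_
    simp [hnab', verticalVector_apply, horizontalPart_apply, (mem_filter.mp hi).2, mul_assoc]
  have hDCa' (α : ℝ) (X Y Z W : EuclideanSpace ℝ (Fin (n + 2))) :
      DCa α X Y Z W = -2 * α * (horizontalInner X Y * horizontalInner Z W +
        horizontalInner X Z * horizontalInner Y W +
        horizontalInner X W * horizontalInner Y Z) := by
    simp only [hDCa, hCa', hnab_zero, hnab_inner, horizontalInner_comm _ (nab _ _)]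
    ring
  refine ⟨⟨fun hsymm => ?_, ?_⟩, hDCa'⟩
  · have hzero (v w) : C 0 v w = 0 := by simpa using hC_smul 0 0 v w
    have hDC_vert (Y Z W) : DC (verticalVector n) Y Z W = 0 := by
      have h (Y) : nab (verticalVector n) Y = 0 := by
        simp [hnab', horizontalInner_comm _ Y, horizontalInner_verticalVector,
          horizontalPart, verticalVector_apply]
      rw [hDC, h, h, h, hC_swap12 Y, hC_swap23 Y, hC_swap12 Y, hzero, hzero, hzero]
      simp
    have hDC_last (X Y Z) : DC X Y Z (verticalVector n) = 0 := by
      have h := hsymm ![X, Y, Z, verticalVector n] (Equiv.swap 0 3)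
      rw [show DC X Y Z (verticalVector n) = _ from h.symm]
      exact hDC_vert _ _ _
    have hnab_vert (X) : nab (horizontalPart X) (verticalVector n) =
        (-1 : ℝ) • horizontalPart X := by
      rw [hnab', horizontalInner_verticalVector, verticalVector_apply]
      simp [horizontalPart, verticalVector_apply]
    have hnab_hor (X Y) : nab (horizontalPart X) (horizontalPart Y) =
        horizontalInner X Y • verticalVector n := by
      rw [hnab', horizontalInner_horizontalPart]
      simp [horizontalPart_apply]
    have hC1 (X) : C (horizontalPart X) (verticalVector n) (verticalVector n) = 0 := by
      have h := hDC_last (horizontalPart X) (verticalVector n) (verticalVector n)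
      rw [hDC, hnab_vert, hC_swap23 _ _ ((-1 : ℝ) • _), hC_swap12 _ ((-1 : ℝ) • _),
        hC_smul] at h
      linarith
    have hC2 (X Y) : C (horizontalPart X) (horizontalPart Y) (verticalVector n) =
        horizontalInner X Y *
          C (verticalVector n) (verticalVector n) (verticalVector n) / 2 := by
      have h := hDC_last (horizontalPart X) (horizontalPart Y) (verticalVector n)
      rw [hDC, hnab_vert, hnab_hor, hC_smul, hC_swap23 _ _ ((-1 : ℝ) • _),
        hC_swap12 _ ((-1 : ℝ) • _), hC_smul] at h
      linarith
    have hC3 (X Y Z) : C (horizontalPart X) (horizontalPart Y) (horizontalPart Z) = 0 := by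
      have h := hDC_last (horizontalPart X) (horizontalPart Y) (horizontalPart Z)
      rw [hDC, hnab_vert, hnab_hor, hnab_hor, hC_smul, hC_swap12 _ (_ • _), hC_smul,
        hC_swap23 _ _ ((-1 : ℝ) • _), hC_swap12 _ ((-1 : ℝ) • _), hC_smul,
        hC_swap12 _ (horizontalPart Z), hC_swap12 _ (horizontalPart Y), hC1, hC1,
        hC_swap23] at h
      rw [hC_swap23]
      linarith
    refine ⟨C (verticalVector n) (verticalVector n) (verticalVector n) / 4, fun u v w => ?_⟩
    rw [cubic_form_decomposition hC_add hC_smul hC_swap12 hC_swap23, hCa', hC1, hC1, hC1, hC2,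
      hC2, hC2, hC3]
    ring
  · rintro ⟨α, hα⟩
    have hDC' (X Y Z W) : DC X Y Z W = -2 * α * (horizontalInner X Y * horizontalInner Z W +
        horizontalInner X Z * horizontalInner Y W +
        horizontalInner X W * horizontalInner Y Z) := by
      rw [← hDCa', hDC, hDCa, hα, hα, hα]
    refine perm_four_invariant (fun X Y Z W => ?_) (fun X Y Z W => ?_) fun X Y Z W => ?_
    · rw [hDC', hDC', horizontalInner_comm Y X]
      ring
    · rw [hDC', hDC', horizontalInner_comm Z Y]
      ring
    · rw [hDC', hDC', horizontalInner_comm W Z]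
      ring
end

section
/- Let n ≥ 2, let E = EuclideanSpace ℝ (Fin n) carry the hyperbolic Lie bracket and Koszul connection ∇ as in the context, and let α ∈ ℝ. Let K be the difference tensor of C^α, i.e., ⟨K(X,Y),Z⟩ = −½·C^α(X,Y,Z), with K_X := K(X,·). Then for all X,Y,Z ∈ E one has [K_X,K_Y]Z = α²(⟨Y,Z⟩X − ⟨X,Z⟩Y), and consequently the curvature of the statistical connection satisfies R^{C^α}(X,Y)Z := ∇_X(∇_Y Z) − ∇_Y(∇_X Z) − ∇_{[X,Y]}Z + [K_X,K_Y]Z = (α² − 1)(⟨Y,Z⟩X − ⟨X,Z⟩Y); in other words R^{C^α}_g = (1−α²)·R⁰_g, so the left-invariant statistical structure (g, C^α) on G_{ℝHⁿ} has constant curvature α² − 1. -/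
open RealInnerProductSpace Finset

/-- The inner product of the components of `X` and `Y` orthogonal to `e₀`. -/
noncomputable def tailInner {n : ℕ} (X Y : EuclideanSpace ℝ (Fin (n + 1))) : ℝ :=
  ∑ i : Fin n, X i.succ * Y i.succ

theorem inner_eq_add_tailInner {n : ℕ} (X Y : EuclideanSpace ℝ (Fin (n + 1))) :
    ⟪X, Y⟫ = X 0 * Y 0 + tailInner X Y := by
  simp [PiLp.inner_apply, Fin.sum_univ_succ, tailInner, mul_comm]

theorem tailInner_comm {n : ℕ} (X Y : EuclideanSpace ℝ (Fin (n + 1))) :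
    tailInner X Y = tailInner Y X := by
  simp [tailInner, mul_comm]

theorem tailInner_of_forall_succ {n : ℕ} {U V W : EuclideanSpace ℝ (Fin (n + 1))} {a b : ℝ}
    (h : ∀ i : Fin n, U i.succ = a * V i.succ + b * W i.succ)
    (X : EuclideanSpace ℝ (Fin (n + 1))) :
    tailInner U X = a * tailInner V X + b * tailInner W X := by
  simp only [tailInner, h, Finset.mul_sum, ← Finset.sum_add_distrib]
  exact Finset.sum_congr rfl fun i _ => by ring

theorem tailInner_single_zero {n : ℕ} (X : EuclideanSpace ℝ (Fin (n + 1))) (a : ℝ) :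
    tailInner X (EuclideanSpace.single 0 a) = 0 := by
  simp [tailInner]

theorem tailInner_single_succ {n : ℕ} (X : EuclideanSpace ℝ (Fin (n + 1))) (i : Fin n) (a : ℝ) :
    tailInner X (EuclideanSpace.single i.succ a) = X i.succ * a := by
  simp [tailInner]

theorem apply_eq_of_inner_eq {n : ℕ} {U V : EuclideanSpace ℝ (Fin (n + 1))} {a b c : ℝ}
    {W : EuclideanSpace ℝ (Fin (n + 1))}
    (h : ∀ Z, ⟪U, Z⟫ = a * Z 0 + b * tailInner V Z + c * tailInner W Z) :
    U 0 = a ∧ ∀ i : Fin n, U i.succ = b * V i.succ + c * W i.succ := by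
  constructor
  · have := h (EuclideanSpace.single 0 1)
    simpa [inner_eq_add_tailInner, tailInner_single_zero] using this
  · intro i
    have := h (EuclideanSpace.single i.succ 1)
    simpa [inner_eq_add_tailInner, tailInner_single_succ, (Fin.succ_ne_zero i).symm] using this

/-- On `𝔤_{ℝHⁿ}` (dimension `n + 2 ≥ 2`), for the cubic form `C^α` with difference tensor `K`
(`⟪K X Y, Z⟫ = -½ C^α X Y Z`), one has `[K_X, K_Y] Z = α²(⟪Y,Z⟫X − ⟪X,Z⟫Y)`, and the curvature
of the statistical connection is `R^{C^α}(X,Y)Z = (α² − 1)(⟪Y,Z⟫X − ⟪X,Z⟫Y)`: the statistical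
structure `(g, C^α)` has constant curvature `α² − 1`. -/
theorem stmt_2 (n : ℕ) (α : ℝ)
    (br nab : EuclideanSpace ℝ (Fin (n + 2)) → EuclideanSpace ℝ (Fin (n + 2)) →
      EuclideanSpace ℝ (Fin (n + 2)))
    (hbr : ∀ X Y (j : Fin (n + 2)), br X Y j =
      if j = 0 then 0 else X 0 * Y j - Y 0 * X j)
    (hnab : ∀ X Y Z, ⟪nab X Y, Z⟫ =
      (1/2 : ℝ) * (⟪br X Y, Z⟫ + ⟪br Z X, Y⟫ + ⟪X, br Z Y⟫))
    (Ca : ℝ → EuclideanSpace ℝ (Fin (n + 2)) → EuclideanSpace ℝ (Fin (n + 2)) →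
      EuclideanSpace ℝ (Fin (n + 2)) → ℝ)
    (hCa : ∀ α u v w, Ca α u v w =
      α * (4 * (u 0 * v 0 * w 0) +
        2 * ∑ i ∈ univ.filter (fun i : Fin (n + 2) => i ≠ 0),
          (u 0 * v i * w i + u i * v 0 * w i + u i * v i * w 0)))
    (K : EuclideanSpace ℝ (Fin (n + 2)) → EuclideanSpace ℝ (Fin (n + 2)) →
      EuclideanSpace ℝ (Fin (n + 2)))
    (hK : ∀ X Y Z, ⟪K X Y, Z⟫ = -(1/2 : ℝ) * Ca α X Y Z) :
    (∀ X Y Z, K X (K Y Z) - K Y (K X Z) =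
      (α ^ 2) • ((⟪Y, Z⟫ : ℝ) • X - (⟪X, Z⟫ : ℝ) • Y)) ∧
    (∀ X Y Z, nab X (nab Y Z) - nab Y (nab X Z) - nab (br X Y) Z +
        (K X (K Y Z) - K Y (K X Z)) =
      (α ^ 2 - 1) • ((⟪Y, Z⟫ : ℝ) • X - (⟪X, Z⟫ : ℝ) • Y)) := by
  have br_zero : ∀ X Y, br X Y 0 = 0 := fun X Y => by simp [hbr]
  have br_succ : ∀ X Y (i : Fin (n + 1)),
      br X Y i.succ = X 0 * Y i.succ + -Y 0 * X i.succ := fun X Y i => by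
    rw [hbr, if_neg (Fin.succ_ne_zero i)]
    ring
  have br_tail : ∀ X Y Z,
      tailInner (br X Y) Z = X 0 * tailInner Y Z + -Y 0 * tailInner X Z :=
    fun X Y => tailInner_of_forall_succ (br_succ X Y)
  have sum_ne_zero : ∀ u v w : EuclideanSpace ℝ (Fin (n + 2)),
      ∑ i ∈ univ.filter (fun i : Fin (n + 2) => i ≠ 0),
          (u 0 * v i * w i + u i * v 0 * w i + u i * v i * w 0) =
        u 0 * tailInner v w + v 0 * tailInner u w + w 0 * tailInner u v := fun u v w => by
    rw [Finset.sum_filter, Fin.sum_univ_succ]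
    simp only [ne_eq, not_true_eq_false, if_false, Fin.succ_ne_zero, not_false_eq_true, if_true,
      zero_add, tailInner, Finset.mul_sum, ← Finset.sum_add_distrib]
    exact Finset.sum_congr rfl fun i _ => by ring
  have K_apply : ∀ X Y, K X Y 0 = -α * (2 * X 0 * Y 0 + tailInner X Y) ∧
      ∀ i : Fin (n + 1), K X Y i.succ = -α * X 0 * Y i.succ + -α * Y 0 * X i.succ :=
    fun X Y => apply_eq_of_inner_eq fun Z => by
      rw [hK, hCa, sum_ne_zero]
      ring
  have K_tail : ∀ X Y Z, tailInner (K X Y) Z =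
      -α * X 0 * tailInner Y Z + -α * Y 0 * tailInner X Z :=
    fun X Y => tailInner_of_forall_succ (K_apply X Y).2
  have nab_apply : ∀ X Y, nab X Y 0 = tailInner X Y ∧
      ∀ i : Fin (n + 1), nab X Y i.succ = -Y 0 * X i.succ + 0 * Y i.succ :=
    fun X Y => apply_eq_of_inner_eq fun Z => by
      rw [hnab]
      simp only [inner_eq_add_tailInner, br_zero, br_tail, tailInner_comm X (br Z Y)]
      rw [tailInner_comm Z Y, tailInner_comm Z X, tailInner_comm Y X]
      ring
  have nab_tail : ∀ X Y Z,
      tailInner (nab X Y) Z = -Y 0 * tailInner X Z + 0 * tailInner Y Z :=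
    fun X Y => tailInner_of_forall_succ (nab_apply X Y).2
  have K_comm : ∀ X Y Z, K X (K Y Z) - K Y (K X Z) =
      (α ^ 2) • ((⟪Y, Z⟫ : ℝ) • X - (⟪X, Z⟫ : ℝ) • Y) := fun X Y Z => by
    ext j
    refine Fin.cases ?_ (fun i => ?_) j <;>
      simp only [PiLp.sub_apply, PiLp.smul_apply, smul_eq_mul, inner_eq_add_tailInner,
        (K_apply _ _).1, (K_apply _ _).2, tailInner_comm X (K _ _), tailInner_comm Y (K _ _),
        K_tail, tailInner_comm Z, tailInner_comm Y X] <;>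
      ring
  refine ⟨K_comm, fun X Y Z => ?_⟩
  rw [K_comm]
  ext j
  refine Fin.cases ?_ (fun i => ?_) j <;>
    simp only [PiLp.add_apply, PiLp.sub_apply, PiLp.smul_apply, smul_eq_mul,
      inner_eq_add_tailInner, (nab_apply _ _).1, (nab_apply _ _).2, br_succ, br_tail,
      tailInner_comm X (nab _ _), tailInner_comm Y (nab _ _), nab_tail, tailInner_comm Y X] <;>
    ring
end

section
/- Let n ≥ 2 and let E = EuclideanSpace ℝ (Fin n) carry the hyperbolic Lie bracket and Koszul connection ∇ as in the context. Let C be a symmetric trilinear form on E whose covariant derivative ∇C is symmetric in all four arguments (i.e., (g,C) is conjugate symmetric), with difference tensor K determined by ⟨K(X,Y),Z⟩ = −½·C(X,Y,Z). Then the curvature R^C(X,Y)Z := ∇_X(∇_Y Z) − ∇_Y(∇_X Z) − ∇_{[X,Y]}Z + [K_X,K_Y]Z vanishes identically if and only if C = C¹ or C = C^{−1}. (Thus the only left-invariant dually flat structures on G_{ℝHⁿ} with the given metric are those with cubic form ±(4x₁³ + 6Σ_{i≥2} x₁xᵢ²).) -/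
open RealInnerProductSpace Finset

section HyperbolicLieAlgebra

variable {m : ℕ}

local notation "E" => EuclideanSpace ℝ (Fin (m + 1))

/-- The distinguished unit vector acting on the abelian ideal of `𝔤_{ℝHⁿ}`. -/
noncomputable def hypUnit (m : ℕ) : EuclideanSpace ℝ (Fin (m + 1)) := EuclideanSpace.single 0 1

lemma hypUnit_apply_zero : hypUnit m 0 = 1 := by simp [hypUnit]

lemma inner_hypUnit_left (X : E) : ⟪hypUnit m, X⟫ = X 0 := by
  simp [hypUnit, EuclideanSpace.inner_single_left]

lemma inner_hypUnit_right (X : E) : ⟪X, hypUnit m⟫ = X 0 := by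
  rw [real_inner_comm, inner_hypUnit_left]

lemma bracket_eq {br : E → E → E}
    (hbr : ∀ X Y (j : Fin (m + 1)), br X Y j = if j = 0 then 0 else X 0 * Y j - Y 0 * X j)
    (X Y : E) : br X Y = X 0 • Y - Y 0 • X := by
  ext j
  rw [hbr]
  split_ifs with h
  · subst h
    simp only [PiLp.sub_apply, PiLp.smul_apply, smul_eq_mul]
    ring
  · simp

lemma koszul_eq {br nab : E → E → E} (hbr : ∀ X Y, br X Y = X 0 • Y - Y 0 • X)
    (hnab : ∀ X Y Z, ⟪nab X Y, Z⟫ =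
      (1/2 : ℝ) * (⟪br X Y, Z⟫ + ⟪br Z X, Y⟫ + ⟪X, br Z Y⟫)) (X Y : E) :
    nab X Y = ⟪X, Y⟫ • hypUnit m - Y 0 • X := by
  refine ext_inner_right ℝ fun Z => ?_
  simp only [hnab, hbr, inner_sub_left, inner_sub_right, inner_smul_left, inner_smul_right,
    inner_hypUnit_left, conj_trivial, real_inner_comm Z Y]
  ring

/-- The cubic form `C^α` written through the inner product. -/
lemma cubicForm_eq (α : ℝ) (u v w : E) :
    α * (4 * (u 0 * v 0 * w 0) +
        2 * ∑ i ∈ univ.filter (fun i : Fin (m + 1) => i ≠ 0),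
          (u 0 * v i * w i + u i * v 0 * w i + u i * v i * w 0)) =
      2 * α * (u 0 * ⟪v, w⟫ + v 0 * ⟪u, w⟫ + w 0 * ⟪u, v⟫ - u 0 * v 0 * w 0) := by
  have hsum : ∑ i ∈ univ.filter (fun i : Fin (m + 1) => i ≠ 0),
      (u 0 * v i * w i + u i * v 0 * w i + u i * v i * w 0) =
      ∑ i, (u 0 * v i * w i + u i * v 0 * w i + u i * v i * w 0) - 3 * (u 0 * v 0 * w 0) := by
    rw [filter_ne' univ (0 : Fin (m + 1)), ← add_sum_erase univ _ (mem_univ (0 : Fin (m + 1)))]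
    ring
  have hinner : ∀ x y : E, ⟪x, y⟫ = ∑ i, x i * y i := fun x y => by
    simp [PiLp.inner_apply, mul_comm]
  rw [hsum, hinner, hinner, hinner, mul_sum, mul_sum, mul_sum, sum_add_distrib, sum_add_distrib]
  have h₁ : ∑ i, u 0 * v i * w i = ∑ i, u 0 * (v i * w i) :=
    sum_congr rfl fun _ _ => by ring
  have h₂ : ∑ i, u i * v 0 * w i = ∑ i, v 0 * (u i * w i) :=
    sum_congr rfl fun _ _ => by ring
  have h₃ : ∑ i, u i * v i * w 0 = ∑ i, w 0 * (u i * v i) :=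
    sum_congr rfl fun _ _ => by ring
  rw [h₁, h₂, h₃]
  ring

/-- Conjugate symmetry forces the cubic form to be a multiple of `C¹`. -/
lemma cubicForm_of_conjugateSymmetric {C : E → E → E → ℝ}
    (hC_add : ∀ u u' v w, C (u + u') v w = C u v w + C u' v w)
    (hC_smul : ∀ (r : ℝ) (u v w : E), C (r • u) v w = r * C u v w)
    (hC_swap12 : ∀ u v w, C u v w = C v u w)
    (hC_swap23 : ∀ u v w, C u v w = C u w v)
    {nab : E → E → E} (hnab : ∀ X Y, nab X Y = ⟪X, Y⟫ • hypUnit m - Y 0 • X)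
    (hsymm : ∀ X Y Z W,
      -C (nab X Y) Z W - C Y (nab X Z) W - C Y Z (nab X W) =
        -C (nab Y X) Z W - C X (nab Y Z) W - C X Z (nab Y W)) (u v w : E) :
    C u v w = 2 * (C (hypUnit m) (hypUnit m) (hypUnit m) / 4) *
      (u 0 * ⟪v, w⟫ + v 0 * ⟪u, w⟫ + w 0 * ⟪u, v⟫ - u 0 * v 0 * w 0) := by
  set e := hypUnit m
  have hcomb₁ : ∀ (a b : ℝ) (x y v w : E),
      C (a • x - b • y) v w = a * C x v w - b * C y v w := fun a b x y v w => by
    rw [sub_eq_add_neg, ← neg_smul, hC_add, hC_smul, hC_smul]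
    ring
  have hcomb₂ : ∀ (a b : ℝ) (x y v w : E),
      C v (a • x - b • y) w = a * C v x w - b * C v y w := fun a b x y v w => by
    rw [hC_swap12, hcomb₁, hC_swap12 x, hC_swap12 y]
  have hcomb₃ : ∀ (a b : ℝ) (x y v w : E),
      C v w (a • x - b • y) = a * C v w x - b * C v w y := fun a b x y v w => by
    rw [hC_swap23, hcomb₂, hC_swap23 v x, hC_swap23 v y]
  have he0 : e 0 = 1 := hypUnit_apply_zero
  have hel : ∀ X : E, ⟪e, X⟫ = X 0 := inner_hypUnit_left
  have her : ∀ X : E, ⟪X, e⟫ = X 0 := inner_hypUnit_right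
  have key : ∀ Y Z W, C Y Z W = Y 0 * C e Z W - Z 0 * C e Y W + ⟪Y, Z⟫ * C e e W
      - W 0 * C e Y Z + ⟪Y, W⟫ * C e e Z := fun Y Z W => by
    have h := hsymm e Y Z W
    simp only [hnab, hcomb₁, hcomb₂, hcomb₃, he0, hel, her] at h
    rw [hC_swap12 Y e W, hC_swap23 Y Z e, hC_swap12 Y e Z, hC_swap23 e Z e, hC_swap23 e Z Y] at h
    linarith
  have h₂ : ∀ Y, C e e Y = Y 0 * C e e e := fun Y => by
    have h := key Y e e
    rw [hC_swap12 Y e e, hC_swap23 e Y e] at h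
    simp only [he0, her] at h
    linarith
  have h₁ : ∀ Y Z, C e Y Z = C e e e / 2 * (⟪Y, Z⟫ + Y 0 * Z 0) := fun Y Z => by
    have h := key Y Z e
    rw [hC_swap23 Y Z e, hC_swap12 Y e Z, hC_swap23 e Z e, hC_swap23 e Y e] at h
    simp only [he0, her, h₂ Y, h₂ Z] at h
    linarith
  rw [key u v w, h₁ v w, h₁ u w, h₁ u v, h₂ v, h₂ w]
  ring

lemma differenceTensor_eq {K : E → E → E} {C : E → E → E → ℝ} {α : ℝ}
    (hK : ∀ X Y Z, ⟪K X Y, Z⟫ = -(1/2 : ℝ) * C X Y Z)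
    (hC : ∀ u v w, C u v w =
      2 * α * (u 0 * ⟪v, w⟫ + v 0 * ⟪u, w⟫ + w 0 * ⟪u, v⟫ - u 0 * v 0 * w 0)) (X Y : E) :
    K X Y = (-α) • (X 0 • Y + Y 0 • X + (⟪X, Y⟫ - X 0 * Y 0) • hypUnit m) := by
  refine ext_inner_right ℝ fun Z => ?_
  simp only [hK, hC, inner_add_left, inner_smul_left, inner_hypUnit_left, conj_trivial]
  ring

/-- The curvature of the structure with cubic form `C^α` on `𝔤_{ℝHⁿ}`. -/
lemma curvature_eq {br nab K : E → E → E} {α : ℝ}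
    (hbr : ∀ X Y, br X Y = X 0 • Y - Y 0 • X)
    (hnab : ∀ X Y, nab X Y = ⟪X, Y⟫ • hypUnit m - Y 0 • X)
    (hK : ∀ X Y, K X Y = (-α) • (X 0 • Y + Y 0 • X + (⟪X, Y⟫ - X 0 * Y 0) • hypUnit m))
    (X Y Z : E) :
    nab X (nab Y Z) - nab Y (nab X Z) - nab (br X Y) Z + (K X (K Y Z) - K Y (K X Z)) =
      (α ^ 2 - 1) • (⟪Y, Z⟫ • X - ⟪X, Z⟫ • Y) := by
  have hYX := real_inner_comm Y X
  ext j
  simp only [hnab, hK, hbr, inner_add_right, inner_sub_left, inner_sub_right,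
    inner_smul_left, inner_smul_right, inner_hypUnit_right, hypUnit_apply_zero, conj_trivial,
    PiLp.add_apply, PiLp.sub_apply, PiLp.smul_apply, smul_eq_mul, hYX]
  ring

end HyperbolicLieAlgebra

/-- On `𝔤_{ℝHⁿ}` (dimension `n + 2 ≥ 2`): a conjugate symmetric left-invariant statistical
structure `(g, C)` (i.e. `∇C` is totally symmetric) is dually flat (the curvature
`R^C(X,Y)Z = R⁰(X,Y)Z + [K_X,K_Y]Z` vanishes identically) iff `C = C¹` or `C = C⁻¹`,
where `C^α = α(4x₁³ + 6∑_{i≥2} x₁xᵢ²)`. -/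
theorem stmt_3 (n : ℕ)
    (br nab : EuclideanSpace ℝ (Fin (n + 2)) → EuclideanSpace ℝ (Fin (n + 2)) →
      EuclideanSpace ℝ (Fin (n + 2)))
    (hbr : ∀ X Y (j : Fin (n + 2)), br X Y j =
      if j = 0 then 0 else X 0 * Y j - Y 0 * X j)
    (hnab : ∀ X Y Z, ⟪nab X Y, Z⟫ =
      (1/2 : ℝ) * (⟪br X Y, Z⟫ + ⟪br Z X, Y⟫ + ⟪X, br Z Y⟫))
    (C : EuclideanSpace ℝ (Fin (n + 2)) → EuclideanSpace ℝ (Fin (n + 2)) →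
      EuclideanSpace ℝ (Fin (n + 2)) → ℝ)
    (hC_add : ∀ u u' v w, C (u + u') v w = C u v w + C u' v w)
    (hC_smul : ∀ (r : ℝ) (u v w : EuclideanSpace ℝ (Fin (n + 2))), C (r • u) v w = r * C u v w)
    (hC_swap12 : ∀ u v w, C u v w = C v u w)
    (hC_swap23 : ∀ u v w, C u v w = C u w v)
    (DC : EuclideanSpace ℝ (Fin (n + 2)) → EuclideanSpace ℝ (Fin (n + 2)) →
      EuclideanSpace ℝ (Fin (n + 2)) → EuclideanSpace ℝ (Fin (n + 2)) → ℝ)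
    (hDC : ∀ X Y Z W, DC X Y Z W =
      -C (nab X Y) Z W - C Y (nab X Z) W - C Y Z (nab X W))
    (hCS : ∀ (v : Fin 4 → EuclideanSpace ℝ (Fin (n + 2))) (σ : Equiv.Perm (Fin 4)),
      DC (v (σ 0)) (v (σ 1)) (v (σ 2)) (v (σ 3)) = DC (v 0) (v 1) (v 2) (v 3))
    (K : EuclideanSpace ℝ (Fin (n + 2)) → EuclideanSpace ℝ (Fin (n + 2)) →
      EuclideanSpace ℝ (Fin (n + 2)))
    (hK : ∀ X Y Z, ⟪K X Y, Z⟫ = -(1/2 : ℝ) * C X Y Z)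
    (Ca : ℝ → EuclideanSpace ℝ (Fin (n + 2)) → EuclideanSpace ℝ (Fin (n + 2)) →
      EuclideanSpace ℝ (Fin (n + 2)) → ℝ)
    (hCa : ∀ α u v w, Ca α u v w =
      α * (4 * (u 0 * v 0 * w 0) +
        2 * ∑ i ∈ univ.filter (fun i : Fin (n + 2) => i ≠ 0),
          (u 0 * v i * w i + u i * v 0 * w i + u i * v i * w 0))) :
    (∀ X Y Z, nab X (nab Y Z) - nab Y (nab X Z) - nab (br X Y) Z +
        (K X (K Y Z) - K Y (K X Z)) = 0) ↔
      ((∀ u v w, C u v w = Ca 1 u v w) ∨ (∀ u v w, C u v w = Ca (-1) u v w)) := by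
  have hbr' := bracket_eq hbr
  have hnab' := koszul_eq hbr' hnab
  have hcurv : ∀ α, (∀ u v w, C u v w = Ca α u v w) → ∀ X Y Z,
      nab X (nab Y Z) - nab Y (nab X Z) - nab (br X Y) Z + (K X (K Y Z) - K Y (K X Z)) =
        (α ^ 2 - 1) • (⟪Y, Z⟫ • X - ⟪X, Z⟫ • Y) := fun α h =>
    curvature_eq hbr' hnab' <| differenceTensor_eq hK fun u v w => by
      rw [h, hCa, cubicForm_eq]
  have hsymm : ∀ X Y Z W, DC X Y Z W = DC Y X Z W := fun X Y Z W =>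
    hCS ![Y, X, Z, W] (Equiv.swap 0 1)
  simp only [hDC] at hsymm
  have hC : ∀ u v w, C u v w = Ca (C (hypUnit _) (hypUnit _) (hypUnit _) / 4) u v w :=
    fun u v w => by
      rw [hCa, cubicForm_eq]
      exact cubicForm_of_conjugateSymmetric hC_add hC_smul hC_swap12 hC_swap23 hnab' hsymm u v w
  constructor
  · intro hflat
    generalize C (hypUnit _) (hypUnit _) (hypUnit _) / 4 = α at hC
    have h := hcurv α hC (hypUnit _) (EuclideanSpace.single 1 1) (EuclideanSpace.single 1 1)
    rw [hflat] at h
    have h0 := congrArg (fun x : EuclideanSpace ℝ (Fin (n + 2)) => x 0) h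
    have hα : α ^ 2 = 1 := by
      simp [hypUnit_apply_zero, inner_hypUnit_left] at h0
      linarith
    rcases eq_or_eq_neg_of_sq_eq_sq α 1 (by rw [hα, one_pow]) with rfl | rfl
    · exact Or.inl hC
    · exact Or.inr hC
  · rintro (h | h) X Y Z <;> rw [hcurv _ h] <;> norm_num
end

section
/- Let n ≥ 2 and let E = EuclideanSpace ℝ (Fin n) carry the hyperbolic Lie bracket as in the context. An orthogonal linear map φ of E (φ ∈ O(n)) is a Lie algebra automorphism (φ[X,Y] = [φX,φY] for all X,Y) if and only if φ(e₁) = e₁ and φ maps span(e₂,…,eₙ) onto itself; i.e., the group Aut(𝔤_{ℝHⁿ}) ∩ O(n) consists exactly of the block matrices diag(1, h₀) with h₀ ∈ O(n−1), so it is isomorphic to SO(1) × O(n−1). Moreover, every such φ leaves each C^α invariant: C^α(φu,φv,φw) = C^α(u,v,w) for all α ∈ ℝ and all u,v,w ∈ E. -/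
open RealInnerProductSpace Finset

section Isometry

variable {n : ℕ} (φ : EuclideanSpace ℝ (Fin (n + 2)) →ₗ[ℝ] EuclideanSpace ℝ (Fin (n + 2)))

/-- The first coordinate is the inner product with the first basis vector. -/
lemma inner_single_zero_eq (X : EuclideanSpace ℝ (Fin (n + 2))) :
    ⟪EuclideanSpace.single 0 (1 : ℝ), X⟫ = X 0 := by
  simp [EuclideanSpace.inner_single_left]

/-- An isometry fixing the first basis vector preserves the first coordinate. -/
lemma map_apply_zero_of_map_single (hφ : ∀ x y, ⟪φ x, φ y⟫ = ⟪x, y⟫)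
    (h : φ (EuclideanSpace.single 0 1) = EuclideanSpace.single 0 1)
    (X : EuclideanSpace ℝ (Fin (n + 2))) : φ X 0 = X 0 := by
  rw [← inner_single_zero_eq, ← inner_single_zero_eq X, ← hφ _ X, h]

/-- An isometry preserving the first coordinate fixes the first basis vector. -/
lemma map_single_zero_of_map_apply_zero (hφ : ∀ x y, ⟪φ x, φ y⟫ = ⟪x, y⟫)
    (h : ∀ X, φ X 0 = X 0) :
    φ (EuclideanSpace.single 0 1) = EuclideanSpace.single 0 1 := by
  rw [← sub_eq_zero, ← inner_self_eq_zero (𝕜 := ℝ), inner_sub_left, inner_sub_right,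
    inner_sub_right, hφ,
    real_inner_comm (EuclideanSpace.single 0 1) (φ (EuclideanSpace.single 0 1))]
  simp only [inner_single_zero_eq, h]
  simp

/-- An isometry preserving the first coordinate maps the span of the other basis vectors
onto itself. -/
lemma image_apply_zero_eq (hφ : ∀ x y, ⟪φ x, φ y⟫ = ⟪x, y⟫)
    (h : ∀ X, φ X 0 = X 0) :
    ⇑φ '' {X : EuclideanSpace ℝ (Fin (n + 2)) | X 0 = 0} =
      {X : EuclideanSpace ℝ (Fin (n + 2)) | X 0 = 0} := by
  have hinj : Function.Injective φ := by
    rw [injective_iff_map_eq_zero]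
    intro x hx
    rw [← inner_self_eq_zero (𝕜 := ℝ), ← hφ, hx, inner_zero_left]
  ext Y
  constructor
  · rintro ⟨X, hX, rfl⟩
    exact (h X).trans hX
  · intro hY
    obtain ⟨X, rfl⟩ := LinearMap.surjective_of_injective hinj Y
    exact ⟨X, (h X).symm.trans hY, rfl⟩

/-- An isometry preserving the bracket `X 0 • Y - Y 0 • X` preserves the first coordinate. -/
lemma map_apply_zero_of_map_bracket (hφ : ∀ x y, ⟪φ x, φ y⟫ = ⟪x, y⟫)
    (h : ∀ X Y, φ (X 0 • Y - Y 0 • X) = φ X 0 • φ Y - φ Y 0 • φ X)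
    (X : EuclideanSpace ℝ (Fin (n + 2))) : φ X 0 = X 0 := by
  set e : EuclideanSpace ℝ (Fin (n + 2)) := EuclideanSpace.single 0 1 with he
  have hee : ⟪e, e⟫ = 1 := by simp [he]
  have he0 : e 0 = 1 := by simp [he]
  have hker (Y : EuclideanSpace ℝ (Fin (n + 2))) (hY : Y 0 = 0) :
      φ Y = φ e 0 • φ Y - φ Y 0 • φ e := by
    rw [← h, he0, hY, one_smul, zero_smul, sub_zero]
  have hzero (Y : EuclideanSpace ℝ (Fin (n + 2))) (hY : Y 0 = 0) : φ Y 0 = 0 := by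
    have h1 := congrArg (fun Z ↦ ⟪φ e, Z⟫) (hker Y hY)
    simp only [inner_sub_right, real_inner_smul_right, hφ, hee] at h1
    rw [he, inner_single_zero_eq, hY] at h1
    linarith
  have hone : φ e 0 = 1 := by
    set f : EuclideanSpace ℝ (Fin (n + 2)) := EuclideanSpace.single 1 1 with hf
    have hf0 : f 0 = 0 := by simp [hf]
    have hff : ⟪f, f⟫ = 1 := by simp [hf]
    have h1 := congrArg (fun Z ↦ ⟪φ f, Z⟫) (hker f hf0)
    simp only [hzero f hf0, zero_smul, sub_zero, real_inner_smul_right, hφ, hff] at h1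
    linarith
  have h2 := hzero (X - X 0 • e) (by simp [he0])
  simp only [map_sub, map_smul, PiLp.sub_apply, PiLp.smul_apply, hone, smul_eq_mul, mul_one] at h2
  linarith

end Isometry

/-- The nonzero-index part of the cubic form in terms of inner products. -/
lemma sum_filter_cubic {n : ℕ} (u v w : EuclideanSpace ℝ (Fin (n + 2))) :
    ∑ i ∈ univ.filter (fun i : Fin (n + 2) => i ≠ 0),
      (u 0 * v i * w i + u i * v 0 * w i + u i * v i * w 0) =
    u 0 * ⟪v, w⟫ + v 0 * ⟪u, w⟫ + w 0 * ⟪u, v⟫ - 3 * (u 0 * v 0 * w 0) := by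
  rw [filter_ne', sum_erase_eq_sub (mem_univ _)]
  simp only [PiLp.inner_apply, mul_sum, ← sum_add_distrib]
  congr 1
  · refine sum_congr rfl fun i _ ↦ ?_
    simp
    ring
  · ring

/-- On `𝔤_{ℝHⁿ}` (dimension `n + 2 ≥ 2`): an orthogonal linear map `φ` is a Lie algebra
automorphism iff `φ e₁ = e₁` and `φ` maps `span(e₂,…,eₙ)` onto itself; moreover every such
`φ` leaves each cubic form `C^α = α(4x₁³ + 6∑_{i≥2} x₁xᵢ²)` invariant. -/
theorem stmt_4 (n : ℕ)
    (br : EuclideanSpace ℝ (Fin (n + 2)) → EuclideanSpace ℝ (Fin (n + 2)) →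
      EuclideanSpace ℝ (Fin (n + 2)))
    (hbr : ∀ X Y (j : Fin (n + 2)), br X Y j =
      if j = 0 then 0 else X 0 * Y j - Y 0 * X j)
    (Ca : ℝ → EuclideanSpace ℝ (Fin (n + 2)) → EuclideanSpace ℝ (Fin (n + 2)) →
      EuclideanSpace ℝ (Fin (n + 2)) → ℝ)
    (hCa : ∀ α u v w, Ca α u v w =
      α * (4 * (u 0 * v 0 * w 0) +
        2 * ∑ i ∈ univ.filter (fun i : Fin (n + 2) => i ≠ 0),
          (u 0 * v i * w i + u i * v 0 * w i + u i * v i * w 0)))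
    (φ : EuclideanSpace ℝ (Fin (n + 2)) →ₗ[ℝ] EuclideanSpace ℝ (Fin (n + 2)))
    (hφ : ∀ x y, ⟪φ x, φ y⟫ = ⟪x, y⟫) :
    ((∀ X Y, φ (br X Y) = br (φ X) (φ Y)) ↔
      (φ (EuclideanSpace.single 0 1) = EuclideanSpace.single 0 1 ∧
        ⇑φ '' {X : EuclideanSpace ℝ (Fin (n + 2)) | X 0 = 0} =
          {X : EuclideanSpace ℝ (Fin (n + 2)) | X 0 = 0})) ∧
    ((∀ X Y, φ (br X Y) = br (φ X) (φ Y)) →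
      ∀ (α : ℝ) (u v w), Ca α (φ u) (φ v) (φ w) = Ca α u v w) := by
  have hbr' : ∀ X Y, br X Y = X 0 • Y - Y 0 • X := by
    intro X Y
    ext j
    rw [hbr]
    split_ifs with hj
    · subst hj
      simp [mul_comm]
    · simp
  have hauto : (∀ X Y, φ (br X Y) = br (φ X) (φ Y)) → ∀ X, φ X 0 = X 0 := fun h ↦
    map_apply_zero_of_map_bracket φ hφ fun X Y ↦ by
      rw [← hbr', h, hbr']
  refine ⟨⟨fun h ↦ ⟨map_single_zero_of_map_apply_zero φ hφ (hauto h), ?_⟩, ?_⟩, ?_⟩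
  · exact image_apply_zero_eq φ hφ (hauto h)
  · rintro ⟨h, -⟩ X Y
    have h0 := map_apply_zero_of_map_single φ hφ h
    simp only [hbr', h0, map_sub, map_smul]
  · intro h α u v w
    rw [hCa, hCa, sum_filter_cubic, sum_filter_cubic]
    simp only [hauto h, hφ]
end

section
/- Let n ≥ 3 and let E = EuclideanSpace ℝ (Fin n) carry the Heisenberg-times-abelian Lie bracket and Koszul connection ∇ as in the context. For a symmetric trilinear form C on E, the quadrilinear form ∇C is symmetric in all four arguments (i.e., the left-invariant statistical structure (g,C) on H³ × ℝ^{n−3} is conjugate symmetric) if and only if there exist real numbers c₄,…,cₙ and a symmetric trilinear form D on E that vanishes whenever one of its arguments lies in span(e₁,e₂,e₃), such that C(u,v,w) = (1/3)(⟨u″,v″⟩p(w) + ⟨u″,w″⟩p(v) + ⟨v″,w″⟩p(u)) + D(u,v,w) for all u,v,w, where u″ denotes the orthogonal projection of u onto span(e₁,e₂,e₃) and p(u) := Σ_{k=4}^n c_k u_k (i.e., C = w₀p₁ + p₃ with w₀ = x₁² + x₂² + x₃², p₁ ∈ S¹, p₃ ∈ S³ of x₄,…,xₙ). Moreover, for every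 such C one has ∇C = 0. In particular, for n = 3 the only conjugate symmetric choice is C = 0. -/
open RealInnerProductSpace Finset

section Heisenberg

variable {n : ℕ}

/-- The `i`-th vector of the standard basis. -/
noncomputable def stdVec (i : Fin (n + 3)) : EuclideanSpace ℝ (Fin (n + 3)) :=
  EuclideanSpace.single i 1

theorem stdVec_apply (i j : Fin (n + 3)) : stdVec i j = if j = i then 1 else 0 := by
  simp [stdVec]

/-- The component of `u` orthogonal to the Heisenberg directions. -/
noncomputable def abelianPart (u : EuclideanSpace ℝ (Fin (n + 3))) :
    EuclideanSpace ℝ (Fin (n + 3)) :=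
  u - u 0 • stdVec 0 - u 1 • stdVec 1 - u 2 • stdVec 2

theorem fin_val_two : ((2 : Fin (n + 3)) : ℕ) = 2 := Nat.mod_eq_of_lt (show 2 < n + 3 by omega)

theorem fin_zero_ne_two : (0 : Fin (n + 3)) ≠ 2 :=
  Fin.ne_of_val_ne (by rw [fin_val_two]; simp)

theorem fin_one_ne_two : (1 : Fin (n + 3)) ≠ 2 :=
  Fin.ne_of_val_ne (by rw [fin_val_two]; simp)

theorem ne_heisenberg_index {j : Fin (n + 3)} (hj : 3 ≤ (j : ℕ)) : j ≠ 0 ∧ j ≠ 1 ∧ j ≠ 2 := by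
  refine ⟨?_, ?_, ?_⟩ <;> rintro rfl
  · simp at hj
  · simp at hj
  · rw [fin_val_two] at hj
    omega

theorem eq_heisenberg_index {j : Fin (n + 3)} (hj : ¬ 3 ≤ (j : ℕ)) : j = 0 ∨ j = 1 ∨ j = 2 := by
  simp only [Fin.ext_iff, fin_val_two, Fin.val_zero, Fin.val_one]
  omega

theorem abelianPart_apply_zero (u : EuclideanSpace ℝ (Fin (n + 3))) : abelianPart u 0 = 0 := by
  simp [abelianPart, stdVec_apply, fin_zero_ne_two]

theorem abelianPart_apply_one (u : EuclideanSpace ℝ (Fin (n + 3))) : abelianPart u 1 = 0 := by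
  simp [abelianPart, stdVec_apply, fin_one_ne_two]

theorem abelianPart_apply_two (u : EuclideanSpace ℝ (Fin (n + 3))) : abelianPart u 2 = 0 := by
  simp [abelianPart, stdVec_apply, fin_zero_ne_two.symm, fin_one_ne_two.symm]

theorem abelianPart_add (u v : EuclideanSpace ℝ (Fin (n + 3))) :
    abelianPart (u + v) = abelianPart u + abelianPart v := by
  simp only [abelianPart, PiLp.add_apply]
  module

theorem abelianPart_smul (r : ℝ) (u : EuclideanSpace ℝ (Fin (n + 3))) :
    abelianPart (r • u) = r • abelianPart u := by
  simp only [abelianPart, PiLp.smul_apply, smul_eq_mul]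
  module

theorem abelianPart_eq_zero {u : EuclideanSpace ℝ (Fin (n + 3))}
    (hu : ∀ j : Fin (n + 3), 3 ≤ (j : ℕ) → u j = 0) : abelianPart u = 0 := by
  ext j
  by_cases hj : 3 ≤ (j : ℕ)
  · obtain ⟨h0, h1, h2⟩ := ne_heisenberg_index hj
    simp [abelianPart, stdVec_apply, h0, h1, h2, hu j hj]
  · obtain rfl | rfl | rfl := eq_heisenberg_index hj
    · exact abelianPart_apply_zero u
    · exact abelianPart_apply_one u
    · exact abelianPart_apply_two u

theorem eq_heisenberg_add_abelianPart (u : EuclideanSpace ℝ (Fin (n + 3))) :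
    u = u 0 • stdVec 0 + u 1 • stdVec 1 + u 2 • stdVec 2 + abelianPart u := by
  simp only [abelianPart]
  module

/-- The Levi-Civita connection of the Heisenberg bracket. -/
noncomputable def heisenbergConn (X Y : EuclideanSpace ℝ (Fin (n + 3))) :
    EuclideanSpace ℝ (Fin (n + 3)) :=
  ((X 1 * Y 2 + X 2 * Y 1) / 2) • stdVec 0 + (-(X 0 * Y 2 + X 2 * Y 0) / 2) • stdVec 1 +
    ((X 0 * Y 1 - X 1 * Y 0) / 2) • stdVec 2

theorem koszul_eq_heisenbergConn
    {br nab : EuclideanSpace ℝ (Fin (n + 3)) → EuclideanSpace ℝ (Fin (n + 3)) →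
      EuclideanSpace ℝ (Fin (n + 3))}
    (hbr : ∀ X Y (j : Fin (n + 3)), br X Y j =
      if j = 2 then X 0 * Y 1 - X 1 * Y 0 else 0)
    (hnab : ∀ X Y Z, ⟪nab X Y, Z⟫ =
      (1/2 : ℝ) * (⟪br X Y, Z⟫ + ⟪br Z X, Y⟫ + ⟪X, br Z Y⟫)) (X Y) :
    nab X Y = heisenbergConn X Y := by
  ext j
  have h := hnab X Y (stdVec j)
  rw [show ⟪nab X Y, stdVec j⟫ = nab X Y j by
    simp [stdVec, EuclideanSpace.inner_single_right]] at h
  rw [h]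
  simp only [PiLp.inner_apply, hbr, RCLike.inner_apply, conj_trivial, mul_ite, ite_mul, mul_zero,
    zero_mul, sum_ite_eq', mem_univ, if_true]
  simp only [heisenbergConn, PiLp.add_apply, PiLp.smul_apply, smul_eq_mul, stdVec_apply, eq_comm]
  ring

theorem heisenbergConn_apply_zero (X Y : EuclideanSpace ℝ (Fin (n + 3))) :
    heisenbergConn X Y 0 = (X 1 * Y 2 + X 2 * Y 1) / 2 := by
  simp [heisenbergConn, stdVec_apply, fin_zero_ne_two]

theorem heisenbergConn_apply_one (X Y : EuclideanSpace ℝ (Fin (n + 3))) :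
    heisenbergConn X Y 1 = -(X 0 * Y 2 + X 2 * Y 0) / 2 := by
  simp [heisenbergConn, stdVec_apply, fin_one_ne_two]

theorem heisenbergConn_apply_two (X Y : EuclideanSpace ℝ (Fin (n + 3))) :
    heisenbergConn X Y 2 = (X 0 * Y 1 - X 1 * Y 0) / 2 := by
  simp [heisenbergConn, stdVec_apply, fin_zero_ne_two.symm, fin_one_ne_two.symm]

theorem heisenbergConn_apply_of_three_le (X Y : EuclideanSpace ℝ (Fin (n + 3)))
    (j : Fin (n + 3)) (hj : 3 ≤ (j : ℕ)) : heisenbergConn X Y j = 0 := by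
  obtain ⟨h0, h1, h2⟩ := ne_heisenberg_index hj
  simp [heisenbergConn, stdVec_apply, h0, h1, h2]

theorem heisenbergConn_abelianPart_left (X Y : EuclideanSpace ℝ (Fin (n + 3))) :
    heisenbergConn (abelianPart X) Y = 0 := by
  simp [heisenbergConn, abelianPart_apply_zero, abelianPart_apply_one, abelianPart_apply_two]

theorem heisenbergConn_abelianPart_right (X Y : EuclideanSpace ℝ (Fin (n + 3))) :
    heisenbergConn X (abelianPart Y) = 0 := by
  simp [heisenbergConn, abelianPart_apply_zero, abelianPart_apply_one, abelianPart_apply_two]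

theorem heisenbergConn_stdVec_self (i : Fin (n + 3)) (hi : i = 0 ∨ i = 1 ∨ i = 2) :
    heisenbergConn (stdVec i) (stdVec i) = 0 := by
  obtain rfl | rfl | rfl := hi <;> simp [heisenbergConn, stdVec_apply, fin_zero_ne_two,
    fin_one_ne_two, fin_zero_ne_two.symm, fin_one_ne_two.symm]

theorem heisenbergConn_zero_one :
    heisenbergConn (stdVec 0 : EuclideanSpace ℝ (Fin (n + 3))) (stdVec 1) =
      (1 / 2 : ℝ) • stdVec 2 := by
  simp [heisenbergConn, stdVec_apply, fin_zero_ne_two.symm, fin_one_ne_two.symm]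

theorem heisenbergConn_one_zero :
    heisenbergConn (stdVec 1 : EuclideanSpace ℝ (Fin (n + 3))) (stdVec 0) =
      (-1 / 2 : ℝ) • stdVec 2 := by
  simp [heisenbergConn, stdVec_apply, fin_zero_ne_two.symm, fin_one_ne_two.symm]

theorem heisenbergConn_zero_two :
    heisenbergConn (stdVec 0 : EuclideanSpace ℝ (Fin (n + 3))) (stdVec 2) =
      (-1 / 2 : ℝ) • stdVec 1 := by
  simp [heisenbergConn, stdVec_apply, fin_zero_ne_two, fin_one_ne_two, fin_zero_ne_two.symm]

theorem heisenbergConn_two_zero :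
    heisenbergConn (stdVec 2 : EuclideanSpace ℝ (Fin (n + 3))) (stdVec 0) =
      (-1 / 2 : ℝ) • stdVec 1 := by
  simp [heisenbergConn, stdVec_apply, fin_zero_ne_two, fin_one_ne_two, fin_zero_ne_two.symm]

theorem heisenbergConn_one_two :
    heisenbergConn (stdVec 1 : EuclideanSpace ℝ (Fin (n + 3))) (stdVec 2) =
      (1 / 2 : ℝ) • stdVec 0 := by
  simp [heisenbergConn, stdVec_apply, fin_zero_ne_two, fin_one_ne_two, fin_one_ne_two.symm]

theorem heisenbergConn_two_one :
    heisenbergConn (stdVec 2 : EuclideanSpace ℝ (Fin (n + 3))) (stdVec 1) =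
      (1 / 2 : ℝ) • stdVec 0 := by
  simp [heisenbergConn, stdVec_apply, fin_zero_ne_two, fin_one_ne_two, fin_one_ne_two.symm]

end Heisenberg

/-- A function of three vectors that is symmetric and linear in each argument. -/
structure IsSymmTrilinear {V : Type*} [AddCommGroup V] [Module ℝ V] (C : V → V → V → ℝ) : Prop where
  add₁ : ∀ u u' v w, C (u + u') v w = C u v w + C u' v w
  smul₁ : ∀ (r : ℝ) u v w, C (r • u) v w = r * C u v w
  swap₁₂ : ∀ u v w, C u v w = C v u w
  swap₂₃ : ∀ u v w, C u v w = C u w v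

namespace IsSymmTrilinear

section Module

variable {V : Type*} [AddCommGroup V] [Module ℝ V] {C : V → V → V → ℝ}

theorem add₂ (hC : IsSymmTrilinear C) (u v v' w : V) : C u (v + v') w = C u v w + C u v' w := by
  rw [hC.swap₁₂, hC.add₁, hC.swap₁₂ v, hC.swap₁₂ v']

theorem smul₂ (hC : IsSymmTrilinear C) (r : ℝ) (u v w : V) : C u (r • v) w = r * C u v w := by
  rw [hC.swap₁₂, hC.smul₁, hC.swap₁₂ v]

theorem add₃ (hC : IsSymmTrilinear C) (u v w w' : V) : C u v (w + w') = C u v w + C u v w' := by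
  rw [hC.swap₂₃, hC.add₂, hC.swap₂₃ u w, hC.swap₂₃ u w']

theorem smul₃ (hC : IsSymmTrilinear C) (r : ℝ) (u v w : V) : C u v (r • w) = r * C u v w := by
  rw [hC.swap₂₃, hC.smul₂, hC.swap₂₃ u w]

theorem zero₁ (hC : IsSymmTrilinear C) (v w : V) : C 0 v w = 0 := by
  simpa using hC.smul₁ 0 0 v w

theorem zero₂ (hC : IsSymmTrilinear C) (u w : V) : C u 0 w = 0 := by
  rw [hC.swap₁₂, hC.zero₁]

theorem zero₃ (hC : IsSymmTrilinear C) (u v : V) : C u v 0 = 0 := by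
  rw [hC.swap₂₃, hC.zero₂]

theorem rotate (hC : IsSymmTrilinear C) (u v w : V) : C u v w = C v w u := by
  rw [hC.swap₁₂, hC.swap₂₃]

end Module

section Heisenberg

variable {n : ℕ} {C : EuclideanSpace ℝ (Fin (n + 3)) → EuclideanSpace ℝ (Fin (n + 3)) →
  EuclideanSpace ℝ (Fin (n + 3)) → ℝ}

theorem abelian_values (hC : IsSymmTrilinear C)
    (codazzi : ∀ X Y Z W, C (heisenbergConn X Y) Z W + C Y (heisenbergConn X Z) W +
      C Y Z (heisenbergConn X W) = C (heisenbergConn Y X) Z W + C X (heisenbergConn Y Z) W +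
      C X Z (heisenbergConn Y W)) (t : EuclideanSpace ℝ (Fin (n + 3))) :
    C (abelianPart t) (stdVec 0) (stdVec 1) = 0 ∧ C (abelianPart t) (stdVec 0) (stdVec 2) = 0 ∧
    C (abelianPart t) (stdVec 1) (stdVec 2) = 0 ∧
    C (abelianPart t) (stdVec 1) (stdVec 1) = C (abelianPart t) (stdVec 0) (stdVec 0) ∧
    C (abelianPart t) (stdVec 2) (stdVec 2) = C (abelianPart t) (stdVec 0) (stdVec 0) ∧
    ∀ s, C (abelianPart t) (abelianPart s) (stdVec 0) = 0 ∧
      C (abelianPart t) (abelianPart s) (stdVec 1) = 0 ∧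
      C (abelianPart t) (abelianPart s) (stdVec 2) = 0 := by
  have invariant : ∀ X Z W, C (abelianPart t) (heisenbergConn X Z) W +
      C (abelianPart t) Z (heisenbergConn X W) = 0 := fun X Z W ↦ by
    have h := codazzi X (abelianPart t) Z W
    simp only [heisenbergConn_abelianPart_left, heisenbergConn_abelianPart_right, hC.zero₁,
      hC.zero₂, hC.zero₃] at h
    linarith
  have hba := hC.swap₂₃ (abelianPart t) (stdVec 1) (stdVec 0)
  have hca := hC.swap₂₃ (abelianPart t) (stdVec 2) (stdVec 0)
  have hcb := hC.swap₂₃ (abelianPart t) (stdVec 2) (stdVec 1)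
  have h1 := invariant (stdVec 2) (stdVec 0) (stdVec 0)
  have h2 := invariant (stdVec 1) (stdVec 0) (stdVec 0)
  have h3 := invariant (stdVec 0) (stdVec 1) (stdVec 1)
  have h4 := invariant (stdVec 2) (stdVec 0) (stdVec 1)
  have h5 := invariant (stdVec 1) (stdVec 0) (stdVec 2)
  simp only [heisenbergConn_zero_one, heisenbergConn_one_zero, heisenbergConn_one_two,
    heisenbergConn_two_zero, heisenbergConn_two_one, hC.smul₂, hC.smul₃] at h1 h2 h3 h4 h5
  refine ⟨by linarith, by linarith, by linarith, by linarith, by linarith, fun s ↦ ?_⟩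
  have k1 := invariant (stdVec 2) (abelianPart s) (stdVec 1)
  have k2 := invariant (stdVec 2) (abelianPart s) (stdVec 0)
  have k3 := invariant (stdVec 1) (abelianPart s) (stdVec 0)
  simp only [heisenbergConn_one_zero, heisenbergConn_two_zero, heisenbergConn_two_one,
    heisenbergConn_abelianPart_right, hC.smul₃, hC.zero₂] at k1 k2 k3
  exact ⟨by linarith, by linarith, by linarith⟩

theorem heisenberg_values (hC : IsSymmTrilinear C)
    (codazzi : ∀ X Y Z W, C (heisenbergConn X Y) Z W + C Y (heisenbergConn X Z) W +
      C Y Z (heisenbergConn X W) = C (heisenbergConn Y X) Z W + C X (heisenbergConn Y Z) W +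
      C X Z (heisenbergConn Y W)) :
    C (stdVec 0) (stdVec 0) (stdVec 0) = 0 ∧ C (stdVec 0) (stdVec 0) (stdVec 1) = 0 ∧
    C (stdVec 0) (stdVec 0) (stdVec 2) = 0 ∧ C (stdVec 0) (stdVec 1) (stdVec 1) = 0 ∧
    C (stdVec 0) (stdVec 1) (stdVec 2) = 0 ∧ C (stdVec 0) (stdVec 2) (stdVec 2) = 0 ∧
    C (stdVec 1) (stdVec 1) (stdVec 1) = 0 ∧ C (stdVec 1) (stdVec 1) (stdVec 2) = 0 ∧
    C (stdVec 1) (stdVec 2) (stdVec 2) = 0 ∧ C (stdVec 2) (stdVec 2) (stdVec 2) = 0 := by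
  have ab_aa := codazzi (stdVec 0) (stdVec 1) (stdVec 0) (stdVec 0)
  have ab_ab := codazzi (stdVec 0) (stdVec 1) (stdVec 0) (stdVec 1)
  have ab_ac := codazzi (stdVec 0) (stdVec 1) (stdVec 0) (stdVec 2)
  have ab_bb := codazzi (stdVec 0) (stdVec 1) (stdVec 1) (stdVec 1)
  have ab_bc := codazzi (stdVec 0) (stdVec 1) (stdVec 1) (stdVec 2)
  have ab_cc := codazzi (stdVec 0) (stdVec 1) (stdVec 2) (stdVec 2)
  have ac_aa := codazzi (stdVec 0) (stdVec 2) (stdVec 0) (stdVec 0)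
  have ac_cc := codazzi (stdVec 0) (stdVec 2) (stdVec 2) (stdVec 2)
  have bc_bb := codazzi (stdVec 1) (stdVec 2) (stdVec 1) (stdVec 1)
  have bc_cc := codazzi (stdVec 1) (stdVec 2) (stdVec 2) (stdVec 2)
  have baa : C (stdVec 1) (stdVec 0) (stdVec 0) = C (stdVec 0) (stdVec 0) (stdVec 1) :=
    by rw [hC.swap₁₂, hC.swap₂₃]
  have bab : C (stdVec 1) (stdVec 0) (stdVec 1) = C (stdVec 0) (stdVec 1) (stdVec 1) :=
    hC.swap₁₂ _ _ _
  have bac : C (stdVec 1) (stdVec 0) (stdVec 2) = C (stdVec 0) (stdVec 1) (stdVec 2) :=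
    hC.swap₁₂ _ _ _
  have caa : C (stdVec 2) (stdVec 0) (stdVec 0) = C (stdVec 0) (stdVec 0) (stdVec 2) :=
    by rw [hC.swap₁₂, hC.swap₂₃]
  have cab : C (stdVec 2) (stdVec 0) (stdVec 1) = C (stdVec 0) (stdVec 1) (stdVec 2) :=
    by rw [hC.swap₁₂, hC.swap₂₃]
  have cac : C (stdVec 2) (stdVec 0) (stdVec 2) = C (stdVec 0) (stdVec 2) (stdVec 2) :=
    hC.swap₁₂ _ _ _
  have cbb : C (stdVec 2) (stdVec 1) (stdVec 1) = C (stdVec 1) (stdVec 1) (stdVec 2) :=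
    by rw [hC.swap₁₂, hC.swap₂₃]
  have cbc : C (stdVec 2) (stdVec 1) (stdVec 2) = C (stdVec 1) (stdVec 2) (stdVec 2) :=
    hC.swap₁₂ _ _ _
  have cca : C (stdVec 2) (stdVec 2) (stdVec 0) = C (stdVec 0) (stdVec 2) (stdVec 2) :=
    by rw [hC.swap₂₃, cac]
  have ccb : C (stdVec 2) (stdVec 2) (stdVec 1) = C (stdVec 1) (stdVec 2) (stdVec 2) :=
    by rw [hC.swap₂₃, cbc]
  have aba : C (stdVec 0) (stdVec 1) (stdVec 0) = C (stdVec 0) (stdVec 0) (stdVec 1) :=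
    hC.swap₂₃ _ _ _
  have aca : C (stdVec 0) (stdVec 2) (stdVec 0) = C (stdVec 0) (stdVec 0) (stdVec 2) :=
    hC.swap₂₃ _ _ _
  have acb : C (stdVec 0) (stdVec 2) (stdVec 1) = C (stdVec 0) (stdVec 1) (stdVec 2) :=
    hC.swap₂₃ _ _ _
  have bba : C (stdVec 1) (stdVec 1) (stdVec 0) = C (stdVec 0) (stdVec 1) (stdVec 1) :=
    by rw [hC.swap₂₃, bab]
  have bcb : C (stdVec 1) (stdVec 2) (stdVec 1) = C (stdVec 1) (stdVec 1) (stdVec 2) :=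
    hC.swap₂₃ _ _ _
  simp only [heisenbergConn_zero_one, heisenbergConn_one_zero, heisenbergConn_zero_two,
    heisenbergConn_two_zero, heisenbergConn_one_two, heisenbergConn_two_one,
    heisenbergConn_stdVec_self, true_or, or_true, hC.smul₁, hC.smul₂, hC.smul₃, hC.zero₂, hC.zero₃,
    baa, bab, bac, caa, cab, cac, cbb, cbc, cca, ccb, aba, aca, acb, bba, bcb]
    at ab_aa ab_ab ab_ac ab_bb ab_bc ab_cc ac_aa ac_cc bc_bb bc_cc
  refine ⟨?_, ?_, ?_, ?_, ?_, ?_, ?_, ?_, ?_, ?_⟩ <;> linarith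

theorem heisenberg_normal_form (hC : IsSymmTrilinear C)
    (codazzi : ∀ X Y Z W, C (heisenbergConn X Y) Z W + C Y (heisenbergConn X Z) W +
      C Y Z (heisenbergConn X W) = C (heisenbergConn Y X) Z W + C X (heisenbergConn Y Z) W +
      C X Z (heisenbergConn Y W)) :
    (∀ u v w, C u v w =
      ((u 0 * v 0 + u 1 * v 1 + u 2 * v 2) * C w (stdVec 0) (stdVec 0) +
        (u 0 * w 0 + u 1 * w 1 + u 2 * w 2) * C v (stdVec 0) (stdVec 0) +
        (v 0 * w 0 + v 1 * w 1 + v 2 * w 2) * C u (stdVec 0) (stdVec 0)) +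
      C (abelianPart u) (abelianPart v) (abelianPart w)) ∧
    C (stdVec 0) (stdVec 0) (stdVec 0) = 0 ∧ C (stdVec 1) (stdVec 0) (stdVec 0) = 0 ∧
    C (stdVec 2) (stdVec 0) (stdVec 0) = 0 := by
  have cubic := hC.heisenberg_values codazzi
  choose habt hact hbct hbbt hcct hst using hC.abelian_values codazzi
  choose hast hbst hcst using hst
  have hdec := eq_heisenberg_add_abelianPart (n := n)
  generalize (stdVec 0 : EuclideanSpace ℝ (Fin (n + 3))) = a at *
  generalize (stdVec 1 : EuclideanSpace ℝ (Fin (n + 3))) = b at *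
  generalize (stdVec 2 : EuclideanSpace ℝ (Fin (n + 3))) = c at *
  obtain ⟨aaa, aab, aac, abb, abc, acc, bbb, bbc, bcc, ccc⟩ := cubic
  have trace_abelianPart : ∀ w, C (abelianPart w) a a = C w a a := fun w ↦ by
    conv_rhs => rw [hdec w]
    simp only [hC.add₁, hC.smul₁, aaa, hC.rotate b a a, hC.rotate c a a, aab, aac]
    ring
  have slot_a : ∀ t w, C (abelianPart t) w a = w 0 * C t a a := fun t w ↦ by
    rw [← trace_abelianPart t]
    conv_lhs => rw [hdec w]
    simp only [hC.add₂, hC.smul₂, hast, hC.swap₂₃ _ b a, hC.swap₂₃ _ c a, habt, hact]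
    ring
  have slot_b : ∀ t w, C (abelianPart t) w b = w 1 * C t a a := fun t w ↦ by
    rw [← trace_abelianPart t]
    conv_lhs => rw [hdec w]
    simp only [hC.add₂, hC.smul₂, hbst, hC.swap₂₃ _ c b, habt, hbct, hbbt]
    ring
  have slot_c : ∀ t w, C (abelianPart t) w c = w 2 * C t a a := fun t w ↦ by
    rw [← trace_abelianPart t]
    conv_lhs => rw [hdec w]
    simp only [hC.add₂, hC.smul₂, hcst, hact, hbct, hcct]
    ring
  have form_aa : ∀ w, C a a w = C w a a := fun w ↦ by rw [hC.rotate, hC.rotate]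
  have form_ab : ∀ w, C a b w = 0 := fun w ↦ by
    rw [hdec w]
    simp only [hC.add₃, hC.smul₃, hC.swap₂₃ a b a, aab, abb, abc, ← hC.rotate (abelianPart w), habt]
    ring
  have form_ac : ∀ w, C a c w = 0 := fun w ↦ by
    rw [hdec w]
    simp only [hC.add₃, hC.smul₃, hC.swap₂₃ a c a, hC.swap₂₃ a c b, aac, abc, acc,
      ← hC.rotate (abelianPart w), hact]
    ring
  have form_bc : ∀ w, C b c w = 0 := fun w ↦ by
    rw [hdec w]
    simp only [hC.add₃, hC.smul₃, ← hC.rotate a b c, hC.swap₂₃ b c b, abc, bbc, bcc,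
      ← hC.rotate (abelianPart w), hbct]
    ring
  have form_bb : ∀ w, C b b w = C w a a := fun w ↦ by
    rw [← trace_abelianPart]
    conv_lhs => rw [hdec w]
    simp only [hC.add₃, hC.smul₃, ← hC.rotate a b b, abb, bbb, bbc, ← hC.rotate (abelianPart w),
      hbbt]
    ring
  have form_cc : ∀ w, C c c w = C w a a := fun w ↦ by
    rw [← trace_abelianPart]
    conv_lhs => rw [hdec w]
    simp only [hC.add₃, hC.smul₃, ← hC.rotate a c c, ← hC.rotate b c c, acc, bcc, ccc,
      ← hC.rotate (abelianPart w), hcct]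
    ring
  refine ⟨fun u v w ↦ ?_, aaa, by rw [hC.rotate, aab], by rw [hC.rotate, aac]⟩
  have form_a : C a v w = v 0 * C w a a + w 0 * C v a a := by
    conv_lhs => rw [hdec v]
    simp only [hC.add₂, hC.smul₂, form_aa, form_ab, form_ac, hC.rotate a (abelianPart v), slot_a]
    ring
  have form_b : C b v w = v 1 * C w a a + w 1 * C v a a := by
    conv_lhs => rw [hdec v]
    simp only [hC.add₂, hC.smul₂, hC.swap₁₂ b a, form_ab, form_bb, form_bc,
      hC.rotate b (abelianPart v), slot_b]
    ring
  have form_c : C c v w = v 2 * C w a a + w 2 * C v a a := by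
    conv_lhs => rw [hdec v]
    simp only [hC.add₂, hC.smul₂, hC.swap₁₂ c a, hC.swap₁₂ c b, form_ac, form_bc, form_cc,
      hC.rotate c (abelianPart v), slot_c]
    ring
  have abelian_mixed : C (abelianPart u) (abelianPart v) w =
      C (abelianPart u) (abelianPart v) (abelianPart w) := by
    conv_lhs => rw [hdec w]
    simp only [hC.add₃, hC.smul₃, hast, hbst, hcst]
    ring
  have form_abelian : C (abelianPart u) v w = (v 0 * w 0 + v 1 * w 1 + v 2 * w 2) * C u a a +
      C (abelianPart u) (abelianPart v) (abelianPart w) := by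
    conv_lhs => rw [hdec v]
    simp only [hC.add₂, hC.smul₂, hC.swap₂₃ (abelianPart u) a w, hC.swap₂₃ (abelianPart u) b w,
      hC.swap₂₃ (abelianPart u) c w, slot_a, slot_b, slot_c, abelian_mixed]
    ring
  conv_lhs => rw [hdec u]
  simp only [hC.add₁, hC.smul₁, form_a, form_b, form_c, form_abelian]
  ring

end Heisenberg

end IsSymmTrilinear

/-- On `𝔥₃ ⊕ ℝ^{n−3}` (bracket `[e₁,e₂] = e₃`; dimension `n + 3 ≥ 3`) with the standard inner
product and its Levi-Civita (Koszul) connection `nab`, a left-invariant cubic form `C` is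
conjugate symmetric (its covariant derivative `DC` is symmetric in all four arguments) iff
`C = w₀p₁ + p₃` where `w₀ = x₁² + x₂² + x₃²`, `p₁(u) = ∑_{k≥4} cₖuₖ` and `p₃ = D` is a
symmetric trilinear form vanishing whenever an argument lies in `span(e₁,e₂,e₃)`.
Moreover `∇C = 0` for such `C`, and for `n + 3 = 3` the only conjugate symmetric cubic
form is `C = 0`. -/
theorem stmt_5 (n : ℕ)
    (br nab : EuclideanSpace ℝ (Fin (n + 3)) → EuclideanSpace ℝ (Fin (n + 3)) →
      EuclideanSpace ℝ (Fin (n + 3)))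
    (hbr : ∀ X Y (j : Fin (n + 3)), br X Y j =
      if j = 2 then X 0 * Y 1 - X 1 * Y 0 else 0)
    (hnab : ∀ X Y Z, ⟪nab X Y, Z⟫ =
      (1/2 : ℝ) * (⟪br X Y, Z⟫ + ⟪br Z X, Y⟫ + ⟪X, br Z Y⟫))
    (C : EuclideanSpace ℝ (Fin (n + 3)) → EuclideanSpace ℝ (Fin (n + 3)) →
      EuclideanSpace ℝ (Fin (n + 3)) → ℝ)
    (hC_add : ∀ u u' v w, C (u + u') v w = C u v w + C u' v w)
    (hC_smul : ∀ (r : ℝ) (u v w : EuclideanSpace ℝ (Fin (n + 3))), C (r • u) v w = r * C u v w)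
    (hC_swap12 : ∀ u v w, C u v w = C v u w)
    (hC_swap23 : ∀ u v w, C u v w = C u w v)
    (DC : EuclideanSpace ℝ (Fin (n + 3)) → EuclideanSpace ℝ (Fin (n + 3)) →
      EuclideanSpace ℝ (Fin (n + 3)) → EuclideanSpace ℝ (Fin (n + 3)) → ℝ)
    (hDC : ∀ X Y Z W, DC X Y Z W =
      -C (nab X Y) Z W - C Y (nab X Z) W - C Y Z (nab X W)) :
    ((∀ (v : Fin 4 → EuclideanSpace ℝ (Fin (n + 3))) (σ : Equiv.Perm (Fin 4)),
        DC (v (σ 0)) (v (σ 1)) (v (σ 2)) (v (σ 3)) = DC (v 0) (v 1) (v 2) (v 3)) ↔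
      ∃ (c : Fin (n + 3) → ℝ)
        (D : EuclideanSpace ℝ (Fin (n + 3)) → EuclideanSpace ℝ (Fin (n + 3)) →
          EuclideanSpace ℝ (Fin (n + 3)) → ℝ),
        (∀ u u' v w, D (u + u') v w = D u v w + D u' v w) ∧
        (∀ (r : ℝ) (u v w : EuclideanSpace ℝ (Fin (n + 3))), D (r • u) v w = r * D u v w) ∧
        (∀ u v w, D u v w = D v u w) ∧
        (∀ u v w, D u v w = D u w v) ∧
        (∀ u v w, ((∀ j : Fin (n + 3), 3 ≤ (j : ℕ) → u j = 0) ∨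
            (∀ j : Fin (n + 3), 3 ≤ (j : ℕ) → v j = 0) ∨
            (∀ j : Fin (n + 3), 3 ≤ (j : ℕ) → w j = 0)) → D u v w = 0) ∧
        (∀ u v w, C u v w =
          (1/3 : ℝ) * ((u 0 * v 0 + u 1 * v 1 + u 2 * v 2) *
              (∑ k ∈ univ.filter (fun k : Fin (n + 3) => 3 ≤ (k : ℕ)), c k * w k) +
            (u 0 * w 0 + u 1 * w 1 + u 2 * w 2) *
              (∑ k ∈ univ.filter (fun k : Fin (n + 3) => 3 ≤ (k : ℕ)), c k * v k) +
            (v 0 * w 0 + v 1 * w 1 + v 2 * w 2) *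
              (∑ k ∈ univ.filter (fun k : Fin (n + 3) => 3 ≤ (k : ℕ)), c k * u k)) +
          D u v w)) ∧
    ((∀ (v : Fin 4 → EuclideanSpace ℝ (Fin (n + 3))) (σ : Equiv.Perm (Fin 4)),
        DC (v (σ 0)) (v (σ 1)) (v (σ 2)) (v (σ 3)) = DC (v 0) (v 1) (v 2) (v 3)) →
      ∀ X Y Z W, DC X Y Z W = 0) ∧
    (n = 0 →
      (∀ (v : Fin 4 → EuclideanSpace ℝ (Fin (n + 3))) (σ : Equiv.Perm (Fin 4)),
        DC (v (σ 0)) (v (σ 1)) (v (σ 2)) (v (σ 3)) = DC (v 0) (v 1) (v 2) (v 3)) →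
      ∀ u v w, C u v w = 0) := by
  have hC : IsSymmTrilinear C := ⟨hC_add, hC_smul, hC_swap12, hC_swap23⟩
  have hk := koszul_eq_heisenbergConn hbr hnab
  have codazzi : (∀ (v : Fin 4 → EuclideanSpace ℝ (Fin (n + 3))) (σ : Equiv.Perm (Fin 4)),
      DC (v (σ 0)) (v (σ 1)) (v (σ 2)) (v (σ 3)) = DC (v 0) (v 1) (v 2) (v 3)) →
      ∀ X Y Z W, C (heisenbergConn X Y) Z W + C Y (heisenbergConn X Z) W +
      C Y Z (heisenbergConn X W) = C (heisenbergConn Y X) Z W + C X (heisenbergConn Y Z) W +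
      C X Z (heisenbergConn Y W) := by
    intro H X Y Z W
    have h : DC X Y Z W = DC Y X Z W := by
      simpa [Equiv.swap_apply_of_ne_of_ne] using (H ![X, Y, Z, W] (Equiv.swap 0 1)).symm
    rw [hDC, hDC] at h
    simp only [hk] at h
    linarith
  have parallel : ∀ (p : EuclideanSpace ℝ (Fin (n + 3)) → ℝ)
      (D : EuclideanSpace ℝ (Fin (n + 3)) → EuclideanSpace ℝ (Fin (n + 3)) →
        EuclideanSpace ℝ (Fin (n + 3)) → ℝ),
      (∀ u, (∀ j : Fin (n + 3), 3 ≤ (j : ℕ) → u j = 0) → p u = 0) →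
      (∀ u v w, ((∀ j : Fin (n + 3), 3 ≤ (j : ℕ) → u j = 0) ∨
        (∀ j : Fin (n + 3), 3 ≤ (j : ℕ) → v j = 0) ∨
        (∀ j : Fin (n + 3), 3 ≤ (j : ℕ) → w j = 0)) → D u v w = 0) →
      (∀ u v w, C u v w = (1/3 : ℝ) * ((u 0 * v 0 + u 1 * v 1 + u 2 * v 2) * p w +
        (u 0 * w 0 + u 1 * w 1 + u 2 * w 2) * p v +
        (v 0 * w 0 + v 1 * w 1 + v 2 * w 2) * p u) + D u v w) →
      ∀ X Y Z W, DC X Y Z W = 0 := by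
    intro p D hp hD hCD X Y Z W
    have hge := heisenbergConn_apply_of_three_le (n := n)
    rw [hDC, hk, hk, hk]
    simp only [hCD, hp _ (hge _ _), hD _ Z W (.inl (hge X Y)), hD Y _ W (.inr (.inl (hge X Z))),
      hD Y Z _ (.inr (.inr (hge X W))), heisenbergConn_apply_zero, heisenbergConn_apply_one,
      heisenbergConn_apply_two]
    ring
  have trace_sum : ∀ w : EuclideanSpace ℝ (Fin (n + 3)),
      C (stdVec 0) (stdVec 0) (stdVec 0) = 0 → C (stdVec 1) (stdVec 0) (stdVec 0) = 0 →
      C (stdVec 2) (stdVec 0) (stdVec 0) = 0 →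
      ∑ k ∈ univ.filter (fun k : Fin (n + 3) => 3 ≤ (k : ℕ)),
        3 * C (stdVec k) (stdVec 0) (stdVec 0) * w k = 3 * C w (stdVec 0) (stdVec 0) := by
    intro w h0 h1 h2
    let L : EuclideanSpace ℝ (Fin (n + 3)) →ₗ[ℝ] ℝ :=
      { toFun := fun u ↦ C u (stdVec 0) (stdVec 0)
        map_add' := fun u v ↦ hC_add u v _ _
        map_smul' := fun r u ↦ hC_smul r u _ _ }
    have hw : w = ∑ k, w k • stdVec k := by
      ext j
      simp [stdVec_apply]
    have hL : C w (stdVec 0) (stdVec 0) = ∑ k, w k * C (stdVec k) (stdVec 0) (stdVec 0) := by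
      change L w = _
      conv_lhs => rw [hw]
      rw [map_sum]
      exact sum_congr rfl fun k _ ↦ hC_smul _ _ _ _
    rw [hL, mul_sum, sum_filter]
    refine sum_congr rfl fun k _ ↦ ?_
    split_ifs with hj
    · ring
    · obtain rfl | rfl | rfl := eq_heisenberg_index hj <;> simp [h0, h1, h2]
  have sum_eq_zero_of_heisenberg : ∀ (c : Fin (n + 3) → ℝ) (u : EuclideanSpace ℝ (Fin (n + 3))),
      (∀ j : Fin (n + 3), 3 ≤ (j : ℕ) → u j = 0) →
      ∑ k ∈ univ.filter (fun k : Fin (n + 3) => 3 ≤ (k : ℕ)), c k * u k = 0 := fun c u hu ↦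
    sum_eq_zero fun k hk ↦ by rw [hu k (mem_filter.1 hk).2, mul_zero]
  have heisenberg_vanish : ∀ u v w, ((∀ j : Fin (n + 3), 3 ≤ (j : ℕ) → u j = 0) ∨
      (∀ j : Fin (n + 3), 3 ≤ (j : ℕ) → v j = 0) ∨
      (∀ j : Fin (n + 3), 3 ≤ (j : ℕ) → w j = 0)) →
      C (abelianPart u) (abelianPart v) (abelianPart w) = 0 := by
    rintro u v w (h | h | h) <;> simp only [abelianPart_eq_zero h, hC.zero₁, hC.zero₂, hC.zero₃]
  have normal_form : (∀ (v : Fin 4 → EuclideanSpace ℝ (Fin (n + 3))) (σ : Equiv.Perm (Fin 4)),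
      DC (v (σ 0)) (v (σ 1)) (v (σ 2)) (v (σ 3)) = DC (v 0) (v 1) (v 2) (v 3)) →
      ∀ u v w, C u v w =
        (1/3 : ℝ) * ((u 0 * v 0 + u 1 * v 1 + u 2 * v 2) *
            (∑ k ∈ univ.filter (fun k : Fin (n + 3) => 3 ≤ (k : ℕ)),
              3 * C (stdVec k) (stdVec 0) (stdVec 0) * w k) +
          (u 0 * w 0 + u 1 * w 1 + u 2 * w 2) *
            (∑ k ∈ univ.filter (fun k : Fin (n + 3) => 3 ≤ (k : ℕ)),
              3 * C (stdVec k) (stdVec 0) (stdVec 0) * v k) +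
          (v 0 * w 0 + v 1 * w 1 + v 2 * w 2) *
            (∑ k ∈ univ.filter (fun k : Fin (n + 3) => 3 ≤ (k : ℕ)),
              3 * C (stdVec k) (stdVec 0) (stdVec 0) * u k)) +
        C (abelianPart u) (abelianPart v) (abelianPart w) := by
    intro H u v w
    obtain ⟨h, h0, h1, h2⟩ := hC.heisenberg_normal_form (codazzi H)
    rw [trace_sum u h0 h1 h2, trace_sum v h0 h1 h2, trace_sum w h0 h1 h2, h u v w]
    ring
  refine ⟨⟨fun H ↦ ⟨fun k ↦ 3 * C (stdVec k) (stdVec 0) (stdVec 0),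
    fun u v w ↦ C (abelianPart u) (abelianPart v) (abelianPart w), ?_, ?_,
    fun _ _ _ ↦ hC_swap12 _ _ _, fun _ _ _ ↦ hC_swap23 _ _ _, heisenberg_vanish,
    normal_form H⟩, ?_⟩, fun H ↦ ?_, ?_⟩
  · intro u u' v w
    simp only [abelianPart_add, hC_add]
  · intro r u v w
    simp only [abelianPart_smul, hC_smul]
  · rintro ⟨c, D, -, -, -, -, hD, hCD⟩ v σ
    have h := parallel _ D (sum_eq_zero_of_heisenberg c) hD hCD
    rw [h, h]
  · exact parallel _ _ (sum_eq_zero_of_heisenberg _) heisenberg_vanish (normal_form H)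
  · rintro rfl H u v w
    have hu : ∀ (u : EuclideanSpace ℝ (Fin (0 + 3))) (j : Fin (0 + 3)), 3 ≤ (j : ℕ) → u j = 0 :=
      fun u j hj ↦ absurd j.isLt (by omega)
    rw [normal_form H, sum_eq_zero_of_heisenberg _ u (hu u), sum_eq_zero_of_heisenberg _ v (hu v),
      sum_eq_zero_of_heisenberg _ w (hu w), heisenberg_vanish u v w (.inl (hu u))]
    ring
end

section
/- Let n ≥ 3 and let E = EuclideanSpace ℝ (Fin n) carry the Heisenberg-times-abelian Lie bracket as in the context. Let c₄,…,cₙ ∈ ℝ, let D be a symmetric trilinear form on E vanishing whenever one of its arguments lies in span(e₁,e₂,e₃), and let C(u,v,w) = (1/3)(⟨u″,v″⟩p(w) + ⟨u″,w″⟩p(v) + ⟨v″,w″⟩p(u)) + D(u,v,w), where u″ is the orthogonal projection of u onto span(e₁,e₂,e₃) and p(u) = Σ_{k=4}^n c_k u_k. Let K be the difference tensor of C, determined by ⟨K(X,Y),Z⟩ = −½·C(X,Y,Z), with K_X := K(X,·). Then ⟨[K_{e₁},K_{e₂}]e₂, e₁⟩ = (1/36)·Σ_{k=4}^n c_k² and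 ⟨[K_{e₁},K_{e₃}]e₃, e₁⟩ = (1/36)·Σ_{k=4}^n c_k². -/
open RealInnerProductSpace Finset

/-- On `𝔥₃ ⊕ ℝ^{n−3}` (dimension `n + 3 ≥ 3`): for the conjugate symmetric cubic form
`C = w₀p₁ + p₃` (with `p₁(u) = ∑_{k≥4} cₖuₖ` and `p₃ = D` supported away from
`span(e₁,e₂,e₃)`) and its difference tensor `K`, one has
`⟪[K_{e₁},K_{e₂}]e₂, e₁⟫ = ⟪[K_{e₁},K_{e₃}]e₃, e₁⟫ = (1/36)∑_{k≥4} cₖ²`. -/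
theorem stmt_6 (n : ℕ) (c : Fin (n + 3) → ℝ)
    (D : EuclideanSpace ℝ (Fin (n + 3)) → EuclideanSpace ℝ (Fin (n + 3)) →
      EuclideanSpace ℝ (Fin (n + 3)) → ℝ)
    (hD_add : ∀ u u' v w, D (u + u') v w = D u v w + D u' v w)
    (hD_smul : ∀ (r : ℝ) (u v w : EuclideanSpace ℝ (Fin (n + 3))), D (r • u) v w = r * D u v w)
    (hD_swap12 : ∀ u v w, D u v w = D v u w)
    (hD_swap23 : ∀ u v w, D u v w = D u w v)
    (hD_vanish : ∀ u v w, ((∀ j : Fin (n + 3), 3 ≤ (j : ℕ) → u j = 0) ∨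
        (∀ j : Fin (n + 3), 3 ≤ (j : ℕ) → v j = 0) ∨
        (∀ j : Fin (n + 3), 3 ≤ (j : ℕ) → w j = 0)) → D u v w = 0)
    (C : EuclideanSpace ℝ (Fin (n + 3)) → EuclideanSpace ℝ (Fin (n + 3)) →
      EuclideanSpace ℝ (Fin (n + 3)) → ℝ)
    (hC : ∀ u v w, C u v w =
      (1/3 : ℝ) * ((u 0 * v 0 + u 1 * v 1 + u 2 * v 2) *
          (∑ k ∈ univ.filter (fun k : Fin (n + 3) => 3 ≤ (k : ℕ)), c k * w k) +
        (u 0 * w 0 + u 1 * w 1 + u 2 * w 2) *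
          (∑ k ∈ univ.filter (fun k : Fin (n + 3) => 3 ≤ (k : ℕ)), c k * v k) +
        (v 0 * w 0 + v 1 * w 1 + v 2 * w 2) *
          (∑ k ∈ univ.filter (fun k : Fin (n + 3) => 3 ≤ (k : ℕ)), c k * u k)) +
      D u v w)
    (K : EuclideanSpace ℝ (Fin (n + 3)) → EuclideanSpace ℝ (Fin (n + 3)) →
      EuclideanSpace ℝ (Fin (n + 3)))
    (hK : ∀ X Y Z, ⟪K X Y, Z⟫ = -(1/2 : ℝ) * C X Y Z) :
    ⟪K (EuclideanSpace.single 0 1) (K (EuclideanSpace.single 1 1) (EuclideanSpace.single 1 1)) -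
        K (EuclideanSpace.single 1 1)
          (K (EuclideanSpace.single 0 1) (EuclideanSpace.single 1 1)),
      EuclideanSpace.single 0 1⟫ =
      (1/36 : ℝ) * ∑ k ∈ univ.filter (fun k : Fin (n + 3) => 3 ≤ (k : ℕ)), (c k) ^ 2 ∧
    ⟪K (EuclideanSpace.single 0 1) (K (EuclideanSpace.single 2 1) (EuclideanSpace.single 2 1)) -
        K (EuclideanSpace.single 2 1)
          (K (EuclideanSpace.single 0 1) (EuclideanSpace.single 2 1)),
      EuclideanSpace.single 0 1⟫ =
      (1/36 : ℝ) * ∑ k ∈ univ.filter (fun k : Fin (n + 3) => 3 ≤ (k : ℕ)), (c k) ^ 2 := by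
  have hcoord : ∀ X Y k, K X Y k = -(1/2 : ℝ) * C X Y (EuclideanSpace.single k 1) := by
    intro X Y k
    rw [← hK, EuclideanSpace.inner_single_right]
    simp
  have hvan : ∀ i : Fin (n + 3), (i : ℕ) < 3 → ∀ j : Fin (n + 3), 3 ≤ (j : ℕ) →
      (EuclideanSpace.single i 1 : EuclideanSpace ℝ (Fin (n + 3))) j = 0 := by
    intro i hi j hj
    have hji : j ≠ i := by
      rintro rfl
      omega
    simp [hji]
  have hp : ∀ u : EuclideanSpace ℝ (Fin (n + 3)), (∀ j : Fin (n + 3), 3 ≤ (j : ℕ) → u j = 0) →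
      ∑ k ∈ univ.filter (fun k : Fin (n + 3) => 3 ≤ (k : ℕ)), c k * u k = 0 := by
    intro u hu
    refine Finset.sum_eq_zero fun k hk => ?_
    rw [hu k (Finset.mem_filter.mp hk).2, mul_zero]
  have h0 : ((0 : Fin (n + 3)) : ℕ) < 3 := by simp
  suffices key : ∀ i : Fin (n + 3), i = 1 ∨ i = 2 →
      ⟪K (EuclideanSpace.single 0 1) (K (EuclideanSpace.single i 1) (EuclideanSpace.single i 1)) -
          K (EuclideanSpace.single i 1)
            (K (EuclideanSpace.single 0 1) (EuclideanSpace.single i 1)),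
        EuclideanSpace.single 0 1⟫ =
        (1/36 : ℝ) * ∑ k ∈ univ.filter (fun k : Fin (n + 3) => 3 ≤ (k : ℕ)), (c k) ^ 2 from
    ⟨key 1 (Or.inl rfl), key 2 (Or.inr rfl)⟩
  intro i hi
  have hi3 : (i : ℕ) < 3 := by
    rcases hi with rfl | rfl
    · rw [Fin.val_one]; omega
    · rw [Fin.val_two]; omega
  have h01 : (0 : Fin (n + 3)) ≠ 1 := by simp
  have h02 : (0 : Fin (n + 3)) ≠ 2 := by rw [Ne, Fin.ext_iff, Fin.val_two]; simp
  have h12 : (1 : Fin (n + 3)) ≠ 2 := by rw [Ne, Fin.ext_iff, Fin.val_two]; simp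
  have hdiag : ∀ k : Fin (n + 3), 3 ≤ (k : ℕ) →
      K (EuclideanSpace.single i 1) (EuclideanSpace.single i 1) k = -(1/6 : ℝ) * c k := by
    intro k hk
    rw [hcoord, hC, hD_vanish _ _ _ (Or.inl (hvan i hi3)), hp _ (hvan i hi3)]
    rcases hi with rfl | rfl <;>
      simp [h01, h02, h12, h12.symm, hk] <;> ring
  have hmixed : ∀ k : Fin (n + 3),
      K (EuclideanSpace.single 0 1) (EuclideanSpace.single i 1) k = 0 := by
    intro k
    rw [hcoord, hC, hD_vanish _ _ _ (Or.inl (hvan 0 h0)), hp _ (hvan i hi3), hp _ (hvan 0 h0)]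
    rcases hi with rfl | rfl <;> simp [h01, h02, h12, h12.symm]
  have hsum : ∑ k ∈ univ.filter (fun k : Fin (n + 3) => 3 ≤ (k : ℕ)),
      c k * K (EuclideanSpace.single i 1) (EuclideanSpace.single i 1) k =
      -(1/6 : ℝ) * ∑ k ∈ univ.filter (fun k : Fin (n + 3) => 3 ≤ (k : ℕ)), (c k) ^ 2 := by
    rw [Finset.mul_sum]
    refine Finset.sum_congr rfl fun k hk => ?_
    rw [hdiag k (Finset.mem_filter.mp hk).2]
    ring
  rw [inner_sub_left, hK, hK, hC, hC, hD_vanish _ _ _ (Or.inl (hvan 0 h0)),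
    hD_vanish _ _ _ (Or.inl (hvan i hi3)), hp _ (hvan 0 h0), hp _ (hvan i hi3), hsum]
  simp [hmixed, h02]
  ring
end

section
/- Let n ≥ 3 and let E = EuclideanSpace ℝ (Fin n) carry the Heisenberg-times-abelian Lie bracket and Koszul connection ∇ as in the context. For every symmetric trilinear form C on E whose covariant derivative ∇C is symmetric in all four arguments (i.e., (g,C) is conjugate symmetric), with difference tensor K given by ⟨K(X,Y),Z⟩ = −½·C(X,Y,Z), the curvature of the statistical connection R^C(X,Y)Z := ∇_X(∇_Y Z) − ∇_Y(∇_X Z) − ∇_{[X,Y]}Z + [K_X,K_Y]Z satisfies ⟨R^C(e₁,e₃)e₃, e₁⟩ ≥ 1/4 > 0; in particular R^C never vanishes identically, so the Lie group H³ × ℝ^{n−3} admits no left-invariant dually flat structure. -/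
open RealInnerProductSpace Finset

/-- On `𝔥₃ ⊕ ℝ^{n−3}` (dimension `n + 3 ≥ 3`): for every conjugate symmetric left-invariant
statistical structure `(g, C)`, the curvature `R^C` of the statistical connection satisfies
`⟪R^C(e₁,e₃)e₃, e₁⟫ ≥ 1/4 > 0`; in particular `R^C` never vanishes identically, so
`H³ × ℝ^{n−3}` admits no left-invariant dually flat structure. -/
theorem stmt_7 (n : ℕ)
    (br nab : EuclideanSpace ℝ (Fin (n + 3)) → EuclideanSpace ℝ (Fin (n + 3)) →
      EuclideanSpace ℝ (Fin (n + 3)))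
    (hbr : ∀ X Y (j : Fin (n + 3)), br X Y j =
      if j = 2 then X 0 * Y 1 - X 1 * Y 0 else 0)
    (hnab : ∀ X Y Z, ⟪nab X Y, Z⟫ =
      (1/2 : ℝ) * (⟪br X Y, Z⟫ + ⟪br Z X, Y⟫ + ⟪X, br Z Y⟫))
    (C : EuclideanSpace ℝ (Fin (n + 3)) → EuclideanSpace ℝ (Fin (n + 3)) →
      EuclideanSpace ℝ (Fin (n + 3)) → ℝ)
    (hC_add : ∀ u u' v w, C (u + u') v w = C u v w + C u' v w)
    (hC_smul : ∀ (r : ℝ) (u v w : EuclideanSpace ℝ (Fin (n + 3))), C (r • u) v w = r * C u v w)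
    (hC_swap12 : ∀ u v w, C u v w = C v u w)
    (hC_swap23 : ∀ u v w, C u v w = C u w v)
    (DC : EuclideanSpace ℝ (Fin (n + 3)) → EuclideanSpace ℝ (Fin (n + 3)) →
      EuclideanSpace ℝ (Fin (n + 3)) → EuclideanSpace ℝ (Fin (n + 3)) → ℝ)
    (hDC : ∀ X Y Z W, DC X Y Z W =
      -C (nab X Y) Z W - C Y (nab X Z) W - C Y Z (nab X W))
    (hCS : ∀ (v : Fin 4 → EuclideanSpace ℝ (Fin (n + 3))) (σ : Equiv.Perm (Fin 4)),
      DC (v (σ 0)) (v (σ 1)) (v (σ 2)) (v (σ 3)) = DC (v 0) (v 1) (v 2) (v 3))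
    (K : EuclideanSpace ℝ (Fin (n + 3)) → EuclideanSpace ℝ (Fin (n + 3)) →
      EuclideanSpace ℝ (Fin (n + 3)))
    (hK : ∀ X Y Z, ⟪K X Y, Z⟫ = -(1/2 : ℝ) * C X Y Z)
    (RC : EuclideanSpace ℝ (Fin (n + 3)) → EuclideanSpace ℝ (Fin (n + 3)) →
      EuclideanSpace ℝ (Fin (n + 3)) → EuclideanSpace ℝ (Fin (n + 3)))
    (hRC : ∀ X Y Z, RC X Y Z = nab X (nab Y Z) - nab Y (nab X Z) - nab (br X Y) Z +
      (K X (K Y Z) - K Y (K X Z))) :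
    (1/4 : ℝ) ≤
      ⟪RC (EuclideanSpace.single 0 1) (EuclideanSpace.single 2 1) (EuclideanSpace.single 2 1),
        EuclideanSpace.single 0 1⟫ ∧
    ¬ (∀ X Y Z, RC X Y Z = 0) := by
  set e : Fin (n + 3) → EuclideanSpace ℝ (Fin (n + 3)) := fun i => EuclideanSpace.single i 1 with he
  have e_apply (i j : Fin (n + 3)) : e i j = if j = i then 1 else 0 := by simp [he]
  have inner_e (x : EuclideanSpace ℝ (Fin (n + 3))) (i : Fin (n + 3)) : ⟪x, e i⟫ = x i := by
    simp [he, EuclideanSpace.inner_single_right]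
  have e_inner (x : EuclideanSpace ℝ (Fin (n + 3))) (i : Fin (n + 3)) : ⟪e i, x⟫ = x i := by
    rw [real_inner_comm, inner_e]
  have h01 : (0 : Fin (n + 3)) ≠ 1 := by simp
  have val_two : 2 % (n + 3) = 2 := Nat.mod_eq_of_lt (by linarith [n.zero_le])
  have h02 : (0 : Fin (n + 3)) ≠ 2 := by simp [Fin.ext_iff, val_two]
  have h12 : (1 : Fin (n + 3)) ≠ 2 := by simp [Fin.ext_iff, val_two]
  have br_eq (X Y) : br X Y = (X 0 * Y 1 - X 1 * Y 0) • e 2 := by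
    ext j
    simp [hbr, e_apply]
  have nab_eq (X Y) : nab X Y = (1 / 2 * (X 1 * Y 2 + X 2 * Y 1)) • e 0 +
      (-(1 / 2) * (X 0 * Y 2 + X 2 * Y 0)) • e 1 +
      (1 / 2 * (X 0 * Y 1 - X 1 * Y 0)) • e 2 := by
    refine ext_inner_right ℝ fun Z => ?_
    simp only [hnab, br_eq, inner_add_left, real_inner_smul_left, real_inner_smul_right, e_inner,
      inner_e]
    ring
  have C_nab (X Y Z W) : C (nab X Y) Z W = 1 / 2 * (X 1 * Y 2 + X 2 * Y 1) * C (e 0) Z W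
      - 1 / 2 * (X 0 * Y 2 + X 2 * Y 0) * C (e 1) Z W
      + 1 / 2 * (X 0 * Y 1 - X 1 * Y 0) * C (e 2) Z W := by
    simp only [nab_eq, hC_add, hC_smul]
    ring
  have DC_eq (X Y Z W) : DC X Y Z W = -C (nab X Y) Z W - C (nab X Z) Y W - C (nab X W) Y Z := by
    rw [hDC, hC_swap12 Y (nab X Z), hC_swap23 Y Z, hC_swap12 Y (nab X W)]
  have DC_swap (X Y Z W) : DC Y X Z W = DC X Y Z W :=
    hCS ![X, Y, Z, W] (Equiv.swap 0 1)
  have DC_swap' (X Y Z W) : DC W Y Z X = DC X Y Z W :=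
    hCS ![X, Y, Z, W] (Equiv.swap 0 3)
  have D (a b c d : Fin (n + 3)) := DC_swap (e a) (e b) (e c) (e d)
  have D' (a b c d : Fin (n + 3)) := DC_swap' (e a) (e b) (e c) (e d)
  have s12 (a b c : Fin (n + 3)) := hC_swap12 (e a) (e b) (e c)
  have s23 (a b c : Fin (n + 3)) := hC_swap23 (e a) (e b) (e c)
  simp only [DC_eq, C_nab, e_apply] at D D'
  have key (i : Fin (n + 3)) :
      C (e 0) (e 2) (e i) = 0 ∧ C (e 2) (e 2) (e i) = C (e 0) (e 0) (e i) := by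
    by_cases hi : i = 0 ∨ i = 1 ∨ i = 2
    · have D0100 := D 0 1 0 0
      have D0101 := D 0 1 0 1
      have D0102 := D 0 1 0 2
      have D0200 := D 0 2 0 0
      have D0201 := D 0 2 0 1
      have D0222 := D 0 2 2 2
      have D1202 := D 1 2 0 2
      have D0111 := D 0 1 1 1
      have D1211 := D 1 2 1 1
      simp [h01, h02, h12, h01.symm, h02.symm, h12.symm, s12 1 0, s12 2 0, s12 2 1, s23 _ 1 0,
        s23 _ 2 0, s23 _ 2 1] at D0100 D0101 D0102 D0200 D0201 D0222 D1202 D1211 D0111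
      rcases hi with rfl | rfl | rfl <;> constructor <;>
        linarith [s23 0 2 0, s23 0 2 1, s12 2 0 2, s23 2 2 0, s12 2 1 2, s23 2 2 1]
    · push Not at hi
      obtain ⟨hi0, hi1, hi2⟩ := hi
      have D001i := D' 0 0 1 i
      have D102i := D' 1 0 2 i
      simp [h01, h02, h12, h01.symm, h02.symm, h12.symm, hi0.symm, hi1.symm,
        hi2.symm, s12 1 0, s12 2 0, s12 2 1] at D001i D102i
      constructor <;> linarith
  have K02 : K (e 0) (e 2) = 0 := by
    ext i
    rw [← inner_e, hK, (key i).1]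
    simp
  have K22 : K (e 2) (e 2) = K (e 0) (e 0) := by
    ext i
    rw [← inner_e, ← inner_e, hK, hK, (key i).2]
  have K_zero : ⟪K (e 2) 0, e 0⟫ = 0 := by
    rw [hK, hC_swap12, ← zero_smul ℝ (0 : EuclideanSpace ℝ (Fin (n + 3))), hC_smul]
    simp
  have K_norm : ⟪K (e 0) (K (e 0) (e 0)), e 0⟫ = ⟪K (e 0) (e 0), K (e 0) (e 0)⟫ := by
    rw [hK, hC_swap23, ← hK]
  have curv : (1 / 4 : ℝ) ≤ ⟪RC (e 0) (e 2) (e 2), e 0⟫ := by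
    have hnn : 0 ≤ ⟪K (e 0) (e 0), K (e 0) (e 0)⟫ := real_inner_self_nonneg
    rw [hRC, K02, K22, inner_add_left, inner_sub_left (K _ _), K_zero, K_norm]
    have : ⟪nab (e 0) (nab (e 2) (e 2)) - nab (e 2) (nab (e 0) (e 2)) - nab (br (e 0) (e 2)) (e 2),
        e 0⟫ = 1 / 4 := by
      simp [inner_e, nab_eq, br_eq, e_apply, h01, h02, h12, h01.symm, h02.symm, h12.symm]
      norm_num
    linarith
  refine ⟨curv, fun h => ?_⟩
  rw [h, inner_zero_left] at curv
  norm_num at curv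
end

section
/- Let n ≥ 3 and let E = EuclideanSpace ℝ (Fin n) carry the Heisenberg-times-abelian Lie bracket as in the context. An orthogonal linear map φ of E (φ ∈ O(n)) is a Lie algebra automorphism (φ[X,Y] = [φX,φY] for all X,Y) if and only if φ preserves each of the subspaces span(e₁,e₂), span(e₃) and span(e₄,…,eₙ), and φ(e₃) = det(A)·e₃ where A ∈ O(2) is the restriction of φ to span(e₁,e₂); i.e., Aut(𝔥₃ ⊕ ℝ^{n−3}) ∩ O(n) is exactly the group of block matrices diag(A, det A, α) with A ∈ O(2) and α ∈ O(n−3), isomorphic to S(O(2)×O(1)) × O(n−3). Moreover, for every such φ that fixes e₄,…,eₙ and every linear functional p vanishing on span(e₁,e₂,e₃), the symmetric trilinear form (u,v,w) ↦ (1/3)(⟨u″,v″⟩p(w) + ⟨u″,w″⟩p(v) + ⟨v″,w″⟩p(u)) (where u″ is the orthogonal projection of u onto span(e₁,e₂,e₃)) is invariant under φ. -/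
open RealInnerProductSpace Finset

/-- A surjective map that respects membership in `S` maps `S` onto itself. -/
lemma image_eq_self_of_mem_iff {α : Type*} {f : α → α} (hf : Function.Surjective f) {S : Set α}
    (h : ∀ x, f x ∈ S ↔ x ∈ S) : f '' S = S := by
  have hS : f ⁻¹' S = S := Set.ext h
  conv_lhs => rw [← hS]
  exact Set.image_preimage_eq S hf

lemma injective_of_inner_map_map {E : Type*} [NormedAddCommGroup E] [InnerProductSpace ℝ E]
    {φ : E →ₗ[ℝ] E} (hφ : ∀ x y, ⟪φ x, φ y⟫ = ⟪x, y⟫) : Function.Injective φ := by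
  refine (injective_iff_map_eq_zero φ).2 fun x hx => ?_
  have h := hφ x x
  rw [hx, inner_zero_left] at h
  exact inner_self_eq_zero.1 h.symm

section Heisenberg

variable {n : ℕ} {br : EuclideanSpace ℝ (Fin (n + 3)) → EuclideanSpace ℝ (Fin (n + 3)) →
  EuclideanSpace ℝ (Fin (n + 3))}

lemma heisenberg_bracket_eq_smul
    (hbr : ∀ X Y (j : Fin (n + 3)), br X Y j = if j = 2 then X 0 * Y 1 - X 1 * Y 0 else 0)
    (X Y : EuclideanSpace ℝ (Fin (n + 3))) :
    br X Y = (X 0 * Y 1 - X 1 * Y 0) • EuclideanSpace.single 2 1 := by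
  ext j
  simp [hbr]

/-- The center is the set of vectors with vanishing first two coordinates. -/
lemma heisenberg_central_iff
    (hbr : ∀ X Y (j : Fin (n + 3)), br X Y j = if j = 2 then X 0 * Y 1 - X 1 * Y 0 else 0)
    (X : EuclideanSpace ℝ (Fin (n + 3))) :
    (∀ Y, br X Y = 0) ↔ X 0 = 0 ∧ X 1 = 0 := by
  constructor
  · intro h
    have h0 := congrArg (fun Z => Z 2) (h (EuclideanSpace.single 0 1))
    have h1 := congrArg (fun Z => Z 2) (h (EuclideanSpace.single 1 1))
    simp [hbr] at h0 h1
    exact ⟨h1, h0⟩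
  · rintro ⟨h0, h1⟩ Y
    rw [heisenberg_bracket_eq_smul hbr, h0, h1]
    simp

end Heisenberg

lemma orthogonal_center_iff {n : ℕ} (X : EuclideanSpace ℝ (Fin (n + 3))) :
    (∀ j : Fin (n + 3), j ≠ 0 → j ≠ 1 → X j = 0) ↔
      ∀ Z : EuclideanSpace ℝ (Fin (n + 3)), (Z 0 = 0 ∧ Z 1 = 0) → ⟪X, Z⟫ = 0 := by
  constructor
  · rintro h Z ⟨h0, h1⟩
    rw [PiLp.inner_apply]
    refine Finset.sum_eq_zero fun j _ => ?_
    by_cases hj0 : j = 0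
    · simp [hj0, h0]
    by_cases hj1 : j = 1
    · simp [hj1, h1]
    simp [h j hj0 hj1]
  · intro h j hj0 hj1
    have := h (EuclideanSpace.single j 1) (by simp [hj0.symm, hj1.symm])
    simpa [EuclideanSpace.inner_single_right] using this

lemma span_single_two_iff {n : ℕ} (X : EuclideanSpace ℝ (Fin (n + 3))) :
    (∀ j : Fin (n + 3), j ≠ 2 → X j = 0) ↔ ∃ c : ℝ, X = c • EuclideanSpace.single 2 1 := by
  constructor
  · intro h
    refine ⟨X 2, ?_⟩
    ext j
    by_cases hj : j = 2
    · simp [hj]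
    · simp [hj, h j hj]
  · rintro ⟨c, rfl⟩ j hj
    simp [hj]

lemma two_mod_add_three (n : ℕ) : 2 % (n + 3) = 2 := Nat.mod_eq_of_lt (by omega)

lemma forall_lt_three_iff {n : ℕ} (X : EuclideanSpace ℝ (Fin (n + 3))) :
    (∀ j : Fin (n + 3), (j : ℕ) < 3 → X j = 0) ↔ (X 0 = 0 ∧ X 1 = 0) ∧ X 2 = 0 := by
  constructor
  · intro h
    exact ⟨⟨h 0 (by simp), h 1 (by simp)⟩, h 2 (by simp [two_mod_add_three])⟩
  · rintro ⟨⟨h0, h1⟩, h2⟩ j hj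
    obtain ⟨j, hj'⟩ := j
    change j < 3 at hj
    interval_cases j
    exacts [h0, h1, h2]

lemma inner_eq_add_sum {n : ℕ} (u v : EuclideanSpace ℝ (Fin (n + 3))) :
    ⟪u, v⟫ = u 0 * v 0 + u 1 * v 1 + u 2 * v 2 +
      ∑ j : Fin n, u j.succ.succ.succ * v j.succ.succ.succ := by
  simp only [PiLp.inner_apply, Fin.sum_univ_succ, RCLike.inner_apply, conj_trivial]
  simp only [mul_comm, Fin.succ_zero_eq_one, Fin.succ_one_eq_two]
  ring

/-- On `𝔥₃ ⊕ ℝ^{n−3}` (dimension `n + 3 ≥ 3`): an orthogonal linear map `φ` is a Lie algebra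
automorphism iff it preserves `span(e₁,e₂)`, `span(e₃)` and `span(e₄,…,eₙ)` and
`φ e₃ = (det A) e₃` where `A` is the restriction of `φ` to `span(e₁,e₂)`. Moreover, every
such `φ` fixing `e₄,…,eₙ` leaves each form `w₀ ⊙ p` invariant, for `p` a linear functional
vanishing on `span(e₁,e₂,e₃)`. -/
theorem stmt_8 (n : ℕ)
    (br : EuclideanSpace ℝ (Fin (n + 3)) → EuclideanSpace ℝ (Fin (n + 3)) →
      EuclideanSpace ℝ (Fin (n + 3)))
    (hbr : ∀ X Y (j : Fin (n + 3)), br X Y j =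
      if j = 2 then X 0 * Y 1 - X 1 * Y 0 else 0)
    (φ : EuclideanSpace ℝ (Fin (n + 3)) →ₗ[ℝ] EuclideanSpace ℝ (Fin (n + 3)))
    (hφ : ∀ x y, ⟪φ x, φ y⟫ = ⟪x, y⟫) :
    ((∀ X Y, φ (br X Y) = br (φ X) (φ Y)) ↔
      (⇑φ '' {X : EuclideanSpace ℝ (Fin (n + 3)) | ∀ j : Fin (n + 3), j ≠ 0 → j ≠ 1 → X j = 0} =
          {X : EuclideanSpace ℝ (Fin (n + 3)) | ∀ j : Fin (n + 3), j ≠ 0 → j ≠ 1 → X j = 0} ∧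
        ⇑φ '' {X : EuclideanSpace ℝ (Fin (n + 3)) | ∀ j : Fin (n + 3), j ≠ 2 → X j = 0} =
          {X : EuclideanSpace ℝ (Fin (n + 3)) | ∀ j : Fin (n + 3), j ≠ 2 → X j = 0} ∧
        ⇑φ '' {X : EuclideanSpace ℝ (Fin (n + 3)) | ∀ j : Fin (n + 3), (j : ℕ) < 3 → X j = 0} =
          {X : EuclideanSpace ℝ (Fin (n + 3)) | ∀ j : Fin (n + 3), (j : ℕ) < 3 → X j = 0} ∧
        φ (EuclideanSpace.single 2 1) =
          (φ (EuclideanSpace.single 0 1) 0 * φ (EuclideanSpace.single 1 1) 1 -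
            φ (EuclideanSpace.single 1 1) 0 * φ (EuclideanSpace.single 0 1) 1) •
            EuclideanSpace.single 2 1)) ∧
    ((∀ X Y, φ (br X Y) = br (φ X) (φ Y)) →
      (∀ k : Fin (n + 3), 3 ≤ (k : ℕ) →
        φ (EuclideanSpace.single k 1) = EuclideanSpace.single k 1) →
      ∀ (p : EuclideanSpace ℝ (Fin (n + 3)) →ₗ[ℝ] ℝ),
        (∀ X : EuclideanSpace ℝ (Fin (n + 3)),
          (∀ j : Fin (n + 3), 3 ≤ (j : ℕ) → X j = 0) → p X = 0) →
        ∀ u v w : EuclideanSpace ℝ (Fin (n + 3)),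
          (1/3 : ℝ) * ((φ u 0 * φ v 0 + φ u 1 * φ v 1 + φ u 2 * φ v 2) * p (φ w) +
              (φ u 0 * φ w 0 + φ u 1 * φ w 1 + φ u 2 * φ w 2) * p (φ v) +
              (φ v 0 * φ w 0 + φ v 1 * φ w 1 + φ v 2 * φ w 2) * p (φ u)) =
          (1/3 : ℝ) * ((u 0 * v 0 + u 1 * v 1 + u 2 * v 2) * p w +
              (u 0 * w 0 + u 1 * w 1 + u 2 * w 2) * p v +
              (v 0 * w 0 + v 1 * w 1 + v 2 * w 2) * p u)) := by
  have hinj := injective_of_inner_map_map hφ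
  have hsurj : Function.Surjective φ := LinearMap.injective_iff_surjective.1 hinj
  refine ⟨⟨fun h => ?_, ?_⟩, ?_⟩
  · have hbracket : br (EuclideanSpace.single 0 1) (EuclideanSpace.single 1 1) =
        EuclideanSpace.single 2 1 := by
      rw [heisenberg_bracket_eq_smul hbr]
      simp
    have he3 := h (EuclideanSpace.single 0 1) (EuclideanSpace.single 1 1)
    rw [hbracket, heisenberg_bracket_eq_smul hbr] at he3
    set d : ℝ := φ (EuclideanSpace.single 0 1) 0 * φ (EuclideanSpace.single 1 1) 1 -
      φ (EuclideanSpace.single 0 1) 1 * φ (EuclideanSpace.single 1 1) 0 with hd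
    have hcoord : ∀ X, d * φ X 2 = X 2 := by
      intro X
      have := hφ X (EuclideanSpace.single 2 1)
      rw [he3, inner_smul_right] at this
      simpa [EuclideanSpace.inner_single_right] using this
    have hd0 : d ≠ 0 := by
      intro h0
      have := hcoord (EuclideanSpace.single 2 1)
      simp [h0] at this
    have hcenter : ∀ X, (φ X 0 = 0 ∧ φ X 1 = 0) ↔ (X 0 = 0 ∧ X 1 = 0) := by
      intro X
      rw [← heisenberg_central_iff hbr, ← heisenberg_central_iff hbr, hsurj.forall]
      simp only [← h, map_eq_zero_iff φ hinj]
    refine ⟨image_eq_self_of_mem_iff hsurj fun X => ?_,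
      image_eq_self_of_mem_iff hsurj fun X => ?_,
      image_eq_self_of_mem_iff hsurj fun X => ?_, ?_⟩
    · simp only [Set.mem_ofPred_eq]
      rw [orthogonal_center_iff, orthogonal_center_iff, hsurj.forall]
      simp only [hcenter, hφ]
    · simp only [Set.mem_ofPred_eq]
      rw [span_single_two_iff, span_single_two_iff]
      constructor
      · rintro ⟨c, hc⟩
        refine ⟨c / d, hinj ?_⟩
        rw [hc, map_smul, he3, smul_smul, div_mul_cancel₀ _ hd0]
      · rintro ⟨c, rfl⟩
        exact ⟨c * d, by rw [map_smul, he3, smul_smul]⟩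
    · simp only [Set.mem_ofPred_eq]
      rw [forall_lt_three_iff, forall_lt_three_iff, hcenter, ← hcoord X]
      simp [hd0]
    · rw [he3, hd]
      congr 1
      ring
  · rintro ⟨-, -, h3, he3⟩ X Y
    have hcoords : ∀ X : EuclideanSpace ℝ (Fin (n + 3)), ∀ i : Fin (n + 3), (i : ℕ) < 2 →
        φ X i = X 0 * φ (EuclideanSpace.single 0 1) i + X 1 * φ (EuclideanSpace.single 1 1) i := by
      intro X i hi
      set R : EuclideanSpace ℝ (Fin (n + 3)) := X - X 0 • EuclideanSpace.single 0 1 -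
        X 1 • EuclideanSpace.single 1 1 - X 2 • EuclideanSpace.single 2 1 with hR
      have hR0 : φ R i = 0 := by
        have hmem : φ R ∈ {X : EuclideanSpace ℝ (Fin (n + 3)) |
            ∀ j : Fin (n + 3), (j : ℕ) < 3 → X j = 0} := by
          rw [← h3]
          refine Set.mem_image_of_mem _ ((forall_lt_three_iff R).2 ?_)
          simp [hR, Fin.ext_iff, two_mod_add_three]
        exact hmem i (by omega)
      have hi2 : i ≠ 2 := by
        rintro rfl
        simp [two_mod_add_three] at hi
      simp only [hR, map_sub, map_smul, he3, PiLp.sub_apply, PiLp.smul_apply, smul_eq_mul,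
        PiLp.single_apply, hi2, if_false, mul_zero, sub_zero] at hR0
      linarith
    rw [heisenberg_bracket_eq_smul hbr, heisenberg_bracket_eq_smul hbr, map_smul, he3, smul_smul,
      hcoords X 0 (by simp), hcoords X 1 (by simp), hcoords Y 0 (by simp),
      hcoords Y 1 (by simp)]
    congr 1
    ring
  · intro _ hfix p hp u v w
    have hcoord : ∀ X, ∀ k : Fin (n + 3), 3 ≤ (k : ℕ) → φ X k = X k := by
      intro X k hk
      have := hφ X (EuclideanSpace.single k 1)
      rw [hfix k hk] at this
      simpa [EuclideanSpace.inner_single_right] using this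
    have hpφ : ∀ X, p (φ X) = p X := by
      intro X
      rw [← sub_eq_zero, ← map_sub]
      exact hp _ fun j hj => by simp [hcoord X j hj]
    have hform : ∀ x y, φ x 0 * φ y 0 + φ x 1 * φ y 1 + φ x 2 * φ y 2 =
        x 0 * y 0 + x 1 * y 1 + x 2 * y 2 := by
      intro x y
      have := hφ x y
      rw [inner_eq_add_sum, inner_eq_add_sum] at this
      have hk : ∀ j : Fin n, 3 ≤ (j.succ.succ.succ : ℕ) := fun j => by simp
      simpa [hcoord _ _ (hk _)] using this
    simp only [hpφ, hform]
end

section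
/- Let n ≥ 1. Let S be the space of symmetric trilinear forms on EuclideanSpace ℝ (Fin n), with O(n) acting by (k·C)(u,v,w) := C(k⁻¹u, k⁻¹v, k⁻¹w). For λ ∈ ℝⁿ let C_λ(u,v,w) := Σᵢ λᵢuᵢvᵢwᵢ, let Ξ := { k·C_λ : k ∈ O(n), λ ∈ ℝⁿ } ⊆ S with the subspace topology, and let V₊ := { λ ∈ ℝⁿ : λ₁ ≥ λ₂ ≥ … ≥ λₙ ≥ 0 }. Then the map V₊ → Ξ/O(n) (the quotient of Ξ by the O(n)-orbit equivalence relation, with the quotient topology) sending λ to the orbit of C_λ is a homeomorphism. -/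
section TrilinearForms

variable {n : ℕ}

local notation "𝔼" n => EuclideanSpace ℝ (Fin n)

/-- The supremum, over all orthonormal bases `(k eⱼ)` of `ℝⁿ`, of `∑ j ∈ s, C(k eⱼ, k eⱼ, k eⱼ)`. -/
noncomputable def kyFan (s : Finset (Fin n))
    (C : ContinuousMultilinearMap ℝ (fun _ : Fin 3 => 𝔼 n) ℝ) : ℝ :=
  ⨆ k : (𝔼 n) ≃ₗᵢ[ℝ] 𝔼 n, ∑ j ∈ s, C fun _ => k (EuclideanSpace.single j 1)

lemma abs_apply_isometry_single_le (C : ContinuousMultilinearMap ℝ (fun _ : Fin 3 => 𝔼 n) ℝ)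
    (k : (𝔼 n) ≃ₗᵢ[ℝ] 𝔼 n) (j : Fin n) :
    |C fun _ => k (EuclideanSpace.single j 1)| ≤ ‖C‖ := by
  simpa using C.le_opNorm fun _ => k (EuclideanSpace.single j 1)

lemma sum_apply_isometry_single_le (s : Finset (Fin n))
    (C : ContinuousMultilinearMap ℝ (fun _ : Fin 3 => 𝔼 n) ℝ) (k : (𝔼 n) ≃ₗᵢ[ℝ] 𝔼 n) :
    ∑ j ∈ s, (C fun _ => k (EuclideanSpace.single j 1)) ≤ s.card * ‖C‖ := by
  simpa using Finset.sum_le_sum fun j (_ : j ∈ s) =>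
    (le_abs_self _).trans (abs_apply_isometry_single_le C k j)

lemma bddAbove_kyFan (s : Finset (Fin n))
    (C : ContinuousMultilinearMap ℝ (fun _ : Fin 3 => 𝔼 n) ℝ) :
    BddAbove (Set.range fun k : (𝔼 n) ≃ₗᵢ[ℝ] 𝔼 n =>
      ∑ j ∈ s, C fun _ => k (EuclideanSpace.single j 1)) := by
  refine ⟨s.card * ‖C‖, ?_⟩
  rintro _ ⟨k, rfl⟩
  exact sum_apply_isometry_single_le s C k

lemma continuous_kyFan (s : Finset (Fin n)) : Continuous (kyFan s) := by
  refine (LipschitzWith.of_le_add_mul (s.card : NNReal) fun C D => ?_).continuous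
  refine ciSup_le fun k => ?_
  have h := sum_apply_isometry_single_le s (C - D) k
  simp only [sub_apply, Finset.sum_sub_distrib] at h
  have hD := le_ciSup (bddAbove_kyFan s D) k
  rw [dist_eq_norm]
  unfold kyFan
  push_cast
  linarith

lemma kyFan_congr_of_isometry (s : Finset (Fin n))
    {C D : ContinuousMultilinearMap ℝ (fun _ : Fin 3 => 𝔼 n) ℝ} (k : (𝔼 n) ≃ₗᵢ[ℝ] 𝔼 n)
    (h : ∀ u v w, D ![u, v, w] = C ![k.symm u, k.symm v, k.symm w]) :
    kyFan s C = kyFan s D := by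
  have hdiag (T : ContinuousMultilinearMap ℝ (fun _ : Fin 3 => 𝔼 n) ℝ) (u : 𝔼 n) :
      (T fun _ => u) = T ![u, u, u] := by
    congr 1
    ext i
    fin_cases i <;> rfl
  refine (Equiv.iSup_congr (Equiv.mulLeft k) fun g => ?_)
  refine Finset.sum_congr rfl fun j _ => ?_
  rw [hdiag, hdiag, h]
  simp

lemma sum_mul_le_sum_of_threshold {s : Finset (Fin n)} {lam p : Fin n → ℝ} {c : ℝ}
    (hs : ∀ i ∈ s, c ≤ lam i) (hs' : ∀ i ∉ s, lam i ≤ c)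
    (hp₀ : ∀ i, 0 ≤ p i) (hp₁ : ∀ i, p i ≤ 1) (hp : ∑ i, p i = s.card) :
    ∑ i, lam i * p i ≤ ∑ i ∈ s, lam i := by
  have h : ∑ i, (lam i - c) * p i ≤ ∑ i, if i ∈ s then lam i - c else 0 := by
    refine Finset.sum_le_sum fun i _ => ?_
    split_ifs with hi
    · nlinarith [hs i hi, hp₁ i]
    · nlinarith [hs' i hi, hp₀ i]
  simp only [sub_mul, Finset.sum_sub_distrib, ← Finset.mul_sum, hp, Finset.sum_ite_mem,
    Finset.univ_inter, Finset.sum_const, nsmul_eq_mul] at h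
  linarith

lemma kyFan_diagonal {C : ContinuousMultilinearMap ℝ (fun _ : Fin 3 => 𝔼 n) ℝ}
    {s : Finset (Fin n)} {lam : Fin n → ℝ} {c : ℝ}
    (hC : ∀ u, (C fun _ => u) = ∑ i, lam i * u i ^ 3) (hlam : ∀ i, 0 ≤ lam i)
    (hs : ∀ i ∈ s, c ≤ lam i) (hs' : ∀ i ∉ s, lam i ≤ c) :
    kyFan s C = ∑ i ∈ s, lam i := by
  refine le_antisymm (ciSup_le fun k => ?_) ?_
  · have hcoord (i j : Fin n) : k (EuclideanSpace.single j 1) i =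
        k.symm (EuclideanSpace.single i 1) j := by
      have := k.inner_map_map (EuclideanSpace.single j 1) (k.symm (EuclideanSpace.single i 1))
      rw [k.apply_symm_apply] at this
      simpa [EuclideanSpace.inner_single_left, EuclideanSpace.inner_single_right] using this
    have hcol (j : Fin n) : ∑ i, k (EuclideanSpace.single j 1) i ^ 2 = 1 := by
      rw [← EuclideanSpace.real_norm_sq_eq]
      simp
    have hrow (i : Fin n) : ∑ j, k (EuclideanSpace.single j 1) i ^ 2 = 1 := by
      simp only [hcoord]
      rw [← EuclideanSpace.real_norm_sq_eq]
      simp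
    have hcube (i j : Fin n) :
        k (EuclideanSpace.single j 1) i ^ 3 ≤ k (EuclideanSpace.single j 1) i ^ 2 := by
      have h : k (EuclideanSpace.single j 1) i ^ 2 ≤ 1 :=
        (hrow i).le.trans' <| Finset.single_le_sum (f := fun j => k (EuclideanSpace.single j 1) i ^ 2)
          (fun j _ => sq_nonneg _) (Finset.mem_univ j)
      have h1 := (abs_le.1 ((sq_le_one_iff_abs_le_one _).1 h)).2
      nlinarith [sq_nonneg (k (EuclideanSpace.single j 1) i)]
    calc ∑ j ∈ s, (C fun _ => k (EuclideanSpace.single j 1))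
        = ∑ i, lam i * ∑ j ∈ s, k (EuclideanSpace.single j 1) i ^ 3 := by
          simp only [hC, Finset.mul_sum]
          exact Finset.sum_comm
      _ ≤ ∑ i, lam i * ∑ j ∈ s, k (EuclideanSpace.single j 1) i ^ 2 :=
          Finset.sum_le_sum fun i _ => mul_le_mul_of_nonneg_left
            (Finset.sum_le_sum fun j _ => hcube i j) (hlam i)
      _ ≤ ∑ i ∈ s, lam i := by
          refine sum_mul_le_sum_of_threshold hs hs'
            (fun i => Finset.sum_nonneg fun j _ => sq_nonneg _) (fun i => ?_) ?_
          · exact (hrow i).le.trans' <| Finset.sum_le_sum_of_subset_of_nonneg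
              (Finset.subset_univ s) fun j _ _ => sq_nonneg _
          · rw [Finset.sum_comm]
            simp [hcol]
  · refine le_of_eq_of_le ?_ (le_ciSup (bddAbove_kyFan s C) 1)
    refine Finset.sum_congr rfl fun j _ => ?_
    simp [hC, PiLp.single_apply, ite_pow]

lemma exists_isometry_sorted_abs (lam : Fin n → ℝ) :
    ∃ (mu : Fin n → ℝ) (l : (𝔼 n) ≃ₗᵢ[ℝ] 𝔼 n),
      ((∀ i j, i ≤ j → mu j ≤ mu i) ∧ ∀ i, 0 ≤ mu i) ∧
      ∀ u v w : 𝔼 n, ∑ i, mu i * (l u i * l v i * l w i) =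
        ∑ i, lam i * (u i * v i * w i) := by
  set σ := Tuple.sort fun i => -|lam i|
  have hσ := Tuple.monotone_sort fun i => -|lam i|
  let flip : (𝔼 n) ≃ₗᵢ[ℝ] 𝔼 n := LinearIsometryEquiv.piLpCongrRight 2 fun i =>
    if 0 ≤ lam i then LinearIsometryEquiv.refl ℝ ℝ else LinearIsometryEquiv.neg ℝ
  refine ⟨fun i => |lam (σ i)|,
    flip.trans (LinearIsometryEquiv.piLpCongrLeft 2 ℝ ℝ σ.symm),
    ⟨fun i j hij => neg_le_neg_iff.1 (hσ hij), fun i => abs_nonneg _⟩, fun u v w => ?_⟩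
  rw [← Equiv.sum_comp σ fun i => lam i * (u i * v i * w i)]
  refine Finset.sum_congr rfl fun i _ => ?_
  have hl (u : 𝔼 n) : (flip.trans (LinearIsometryEquiv.piLpCongrLeft 2 ℝ ℝ σ.symm)) u i =
      if 0 ≤ lam (σ i) then u (σ i) else -u (σ i) := by
    simp only [flip, LinearIsometryEquiv.trans_apply, LinearIsometryEquiv.piLpCongrLeft_apply,
      LinearIsometryEquiv.piLpCongrRight_apply, Equiv.piCongrLeft'_apply, Equiv.symm_symm]
    split_ifs <;> simp
  simp only [hl]
  split_ifs with h
  · rw [abs_of_nonneg h]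
  · rw [abs_of_neg (not_le.1 h)]
    ring

lemma continuous_of_diagonal
    {Clam : (Fin n → ℝ) → ContinuousMultilinearMap ℝ (fun _ : Fin 3 => 𝔼 n) ℝ}
    (hClam : ∀ (lam : Fin n → ℝ) (u v w : 𝔼 n),
      Clam lam ![u, v, w] = ∑ i, lam i * (u i * v i * w i)) : Continuous Clam := by
  have happ (lam : Fin n → ℝ) (m : Fin 3 → 𝔼 n) :
      Clam lam m = ∑ i, lam i * (m 0 i * m 1 i * m 2 i) := by
    rw [← hClam]
    congr 1
    ext i
    fin_cases i <;> rfl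
  let L : (Fin n → ℝ) →ₗ[ℝ] ContinuousMultilinearMap ℝ (fun _ : Fin 3 => 𝔼 n) ℝ :=
    { toFun := Clam
      map_add' := fun a b => by
        ext m
        simp [happ, add_mul, Finset.sum_add_distrib]
      map_smul' := fun a b => by
        ext m
        simp [happ, mul_assoc, Finset.mul_sum] }
  exact L.continuous_of_finiteDimensional

end TrilinearForms


/-- Let `S` be the space of (continuous) trilinear forms on `ℝⁿ`, `C_λ(u,v,w) = ∑ λᵢuᵢvᵢwᵢ`,
`Ξ = O(n)·{C_λ}` with the subspace topology and `V₊ = {λ : λ₁ ≥ … ≥ λₙ ≥ 0}`. Then the map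
`V₊ → Ξ/O(n)` sending `λ` to the orbit of `C_λ` is a homeomorphism (where `Ξ/O(n)` is the
orbit space with the quotient topology). -/
theorem stmt_10 (n : ℕ) (hn : 1 ≤ n)
    (Clam : (Fin n → ℝ) →
      ContinuousMultilinearMap ℝ (fun _ : Fin 3 => EuclideanSpace ℝ (Fin n)) ℝ)
    (hClam : ∀ (lam : Fin n → ℝ) (u v w : EuclideanSpace ℝ (Fin n)),
      Clam lam ![u, v, w] = ∑ i, lam i * (u i * v i * w i))
    (hClamSymm : ∀ (lam : Fin n → ℝ) (v : Fin 3 → EuclideanSpace ℝ (Fin n))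
      (σ : Equiv.Perm (Fin 3)), Clam lam (v ∘ σ) = Clam lam v)
    (Xi : Set (ContinuousMultilinearMap ℝ (fun _ : Fin 3 => EuclideanSpace ℝ (Fin n)) ℝ))
    (hXi : Xi = {C | ∃ (k : EuclideanSpace ℝ (Fin n) ≃ₗᵢ[ℝ] EuclideanSpace ℝ (Fin n))
      (lam : Fin n → ℝ), ∀ u v w : EuclideanSpace ℝ (Fin n),
        C ![u, v, w] = Clam lam ![k.symm u, k.symm v, k.symm w]})
    (r : Xi → Xi → Prop)
    (hr : ∀ C C' : Xi, r C C' ↔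
      ∃ k : EuclideanSpace ℝ (Fin n) ≃ₗᵢ[ℝ] EuclideanSpace ℝ (Fin n),
        ∀ u v w : EuclideanSpace ℝ (Fin n),
          C'.val ![u, v, w] = C.val ![k.symm u, k.symm v, k.symm w])
    (f : {lam : Fin n → ℝ // (∀ i j : Fin n, i ≤ j → lam j ≤ lam i) ∧ ∀ i, 0 ≤ lam i} →
      Quot r)
    (hf : ∀ (lam : {lam : Fin n → ℝ // (∀ i j : Fin n, i ≤ j → lam j ≤ lam i) ∧
        ∀ i, 0 ≤ lam i}) (hmem : Clam lam.val ∈ Xi),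
      f lam = Quot.mk r ⟨Clam lam.val, hmem⟩) :
    IsHomeomorph f := by
  have hmem (lam : Fin n → ℝ) : Clam lam ∈ Xi := by
    rw [hXi]
    exact ⟨1, lam, fun u v w => rfl⟩
  have hf_eq : f = fun lam => Quot.mk r ⟨Clam lam.val, hmem _⟩ := funext fun lam => hf lam _
  have hcont : Continuous f := by
    rw [hf_eq]
    exact continuous_quot_mk.comp
      (((continuous_of_diagonal hClam).comp continuous_subtype_val).subtype_mk _)
  have hsurj : Function.Surjective f := by
    rintro ⟨C, hC⟩
    obtain ⟨k, lam, hk⟩ := hXi ▸ hC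
    obtain ⟨mu, l, hmu, hl⟩ := exists_isometry_sorted_abs lam
    refine ⟨⟨mu, hmu⟩, (hf _ (hmem mu)).trans (Quot.sound ((hr _ _).2 ⟨l.symm.trans k, ?_⟩))⟩
    intro u v w
    rw [hk, hClam, hClam, ← hl]
    rfl
  let F (s : Finset (Fin n)) : Quot r → ℝ := Quot.lift (fun C => kyFan s C.val) fun C D h => by
    obtain ⟨k, hk⟩ := (hr C D).1 h
    exact kyFan_congr_of_isometry s k hk
  have hF (s : Finset (Fin n)) : Continuous (F s) :=
    continuous_quot_lift _ ((continuous_kyFan s).comp continuous_subtype_val)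
  let g : Quot r → Fin n → ℝ := fun q t => F (Finset.Iic t) q - F (Finset.Iio t) q
  have hg : Continuous g := continuous_pi fun t => (hF _).sub (hF _)
  have hgf : g ∘ f = Subtype.val := by
    funext ⟨lam, hanti, hnonneg⟩ t
    have hC (u : EuclideanSpace ℝ (Fin n)) :
        (Clam lam fun _ => u) = ∑ i, lam i * u i ^ 3 := by
      have : (fun _ => u) = ![u, u, u] := by
        ext i
        fin_cases i <;> rfl
      rw [this, hClam]
      exact Finset.sum_congr rfl fun i _ => by ring
    have hIic : kyFan (Finset.Iic t) (Clam lam) = ∑ i ∈ Finset.Iic t, lam i :=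
      kyFan_diagonal (c := lam t) hC hnonneg (fun i hi => hanti _ _ (Finset.mem_Iic.1 hi))
        fun i hi => hanti _ _ (by simpa using (lt_of_not_ge (by simpa using hi)).le)
    have hIio : kyFan (Finset.Iio t) (Clam lam) = ∑ i ∈ Finset.Iio t, lam i :=
      kyFan_diagonal (c := lam t) hC hnonneg (fun i hi => hanti _ _ (Finset.mem_Iio.1 hi).le)
        fun i hi => hanti _ _ (by simpa using hi)
    have hsum : ∑ i ∈ Finset.Iic t, lam i = lam t + ∑ i ∈ Finset.Iio t, lam i := by
      rw [← Finset.Iio_insert, Finset.sum_insert (by simp)]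
    simp only [Function.comp_apply, hf_eq, g, F, hIic, hIio, hsum, add_sub_cancel_right]
  have hemb : Topology.IsEmbedding f :=
    .of_comp hcont hg (hgf ▸ Topology.IsEmbedding.subtypeVal)
  exact isHomeomorph_iff_isEmbedding_surjective.2 ⟨hemb, hsurj⟩
end

section
/- Let n ≥ 1. For λ ∈ ℝⁿ let C_λ be the symmetric trilinear form on EuclideanSpace ℝ (Fin n) given by C_λ(u,v,w) := Σᵢ λᵢuᵢvᵢwᵢ. Suppose λ, μ ∈ ℝⁿ and k ∈ O(n) satisfy C_λ(k⁻¹u, k⁻¹v, k⁻¹w) = C_μ(u,v,w) for all u,v,w. Then there exists a signed permutation k′ ∈ O(n) — i.e., k′(eᵢ) = εᵢ e_{σ(i)} for some permutation σ of {1,…,n} and signs εᵢ ∈ {±1} — such that C_λ(k′⁻¹u, k′⁻¹v, k′⁻¹w) = C_μ(u,v,w) for all u,v,w. -/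
/-- A square matrix with nonzero determinant has a generalized diagonal with nonzero entries. -/
theorem Matrix.exists_perm_forall_apply_ne_zero {ι R : Type*} [Fintype ι] [DecidableEq ι]
    [CommRing R] {M : Matrix ι ι R} (hM : M.det ≠ 0) :
    ∃ σ : Equiv.Perm ι, ∀ i, M (σ i) i ≠ 0 := by
  rw [Matrix.det_apply] at hM
  obtain ⟨σ, -, hσ⟩ := Finset.exists_ne_zero_of_sum_ne_zero hM
  refine ⟨σ, fun i hi => hσ ?_⟩
  rw [Finset.prod_eq_zero (f := fun j => M (σ j) j) (Finset.mem_univ i) hi, smul_zero]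

/-- The isometry of Euclidean space sending `eᵢ` to `ε i • e_{σ i}`, where `ε i ^ 2 = 1`. -/
noncomputable def signedPermIsometry {ι : Type*} [Fintype ι] (σ : Equiv.Perm ι) (ε : ι → ℝ)
    (hε : ∀ i, ε i * ε i = 1) : EuclideanSpace ℝ ι ≃ₗᵢ[ℝ] EuclideanSpace ℝ ι where
  toFun u := WithLp.toLp 2 fun i => ε (σ.symm i) * u (σ.symm i)
  invFun u := WithLp.toLp 2 fun i => ε i * u (σ i)
  map_add' u v := by ext i; simp [mul_add]
  map_smul' c u := by ext i; simp [mul_left_comm]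
  left_inv u := by ext i; simp [← mul_assoc, hε]
  right_inv u := by ext i; simp [← mul_assoc, hε]
  norm_map' u := by
    have hsq : ∀ i, ε i ^ 2 = 1 := fun i => by rw [sq, hε]
    simp only [EuclideanSpace.norm_eq, LinearEquiv.coe_mk, LinearMap.coe_mk, AddHom.coe_mk,
      Real.norm_eq_abs, sq_abs, mul_pow, hsq, one_mul]
    rw [Equiv.sum_comp σ.symm fun i => u i ^ 2]

theorem signedPermIsometry_single {ι : Type*} [Fintype ι] [DecidableEq ι] (σ : Equiv.Perm ι)
    (ε : ι → ℝ) (hε : ∀ i, ε i * ε i = 1) (i : ι) :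
    signedPermIsometry σ ε hε (EuclideanSpace.single i 1) =
      ε i • EuclideanSpace.single (σ i) 1 := by
  ext j
  change ε (σ.symm j) * EuclideanSpace.single i (1 : ℝ) (σ.symm j) = _
  by_cases hj : j = σ i
  · simp [hj]
  · have : σ.symm j ≠ i := fun h => hj (by simp [← h])
    simp [hj, this]

theorem signedPermIsometry_symm_apply {ι : Type*} [Fintype ι] (σ : Equiv.Perm ι) (ε : ι → ℝ)
    (hε : ∀ i, ε i * ε i = 1) (u : EuclideanSpace ℝ ι) (i : ι) :
    (signedPermIsometry σ ε hε).symm u i = ε i * u (σ i) :=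
  rfl

/-- Some permutation `σ` has all the matrix entries `(k eᵢ)_{σ i}` of an isometry `k` nonzero. -/
theorem LinearIsometryEquiv.exists_perm_forall_apply_single_ne_zero {ι : Type*} [Fintype ι]
    [DecidableEq ι] (k : EuclideanSpace ℝ ι ≃ₗᵢ[ℝ] EuclideanSpace ℝ ι) :
    ∃ σ : Equiv.Perm ι, ∀ i, k (EuclideanSpace.single i 1) (σ i) ≠ 0 := by
  let M : Matrix ι ι ℝ := Matrix.of fun a j => k (EuclideanSpace.single j 1) a
  have hM : M.transpose * M = 1 := by
    ext i j
    have := k.inner_map_map (EuclideanSpace.single i 1) (EuclideanSpace.single j 1)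
    rw [PiLp.inner_apply, EuclideanSpace.inner_single_left] at this
    simpa [M, Matrix.mul_apply, Matrix.one_apply, mul_comm] using this
  exact Matrix.exists_perm_forall_apply_ne_zero
    (Matrix.isUnit_det_of_left_inverse hM).ne_zero


/-- If two diagonal cubic forms `C_λ(u,v,w) = ∑ λᵢuᵢvᵢwᵢ` and `C_μ` on `ℝⁿ` are related by an
orthogonal transformation `k` (i.e. `k·C_λ = C_μ`), then they are related by a signed
permutation `k′ ∈ O(n)`. -/
theorem stmt_11 (n : ℕ) (hn : 1 ≤ n) (lam mu : Fin n → ℝ)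
    (k : EuclideanSpace ℝ (Fin n) ≃ₗᵢ[ℝ] EuclideanSpace ℝ (Fin n))
    (h : ∀ u v w : EuclideanSpace ℝ (Fin n),
      ∑ i, lam i * (k.symm u i * k.symm v i * k.symm w i) =
        ∑ i, mu i * (u i * v i * w i)) :
    ∃ (k' : EuclideanSpace ℝ (Fin n) ≃ₗᵢ[ℝ] EuclideanSpace ℝ (Fin n))
      (σ : Equiv.Perm (Fin n)) (ε : Fin n → ℝ),
      (∀ i, ε i = 1 ∨ ε i = -1) ∧
      (∀ i, k' (EuclideanSpace.single i 1) = ε i • EuclideanSpace.single (σ i) 1) ∧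
      ∀ u v w : EuclideanSpace ℝ (Fin n),
        ∑ i, lam i * (k'.symm u i * k'.symm v i * k'.symm w i) =
          ∑ i, mu i * (u i * v i * w i) := by
  obtain ⟨σ, hσ⟩ := k.exists_perm_forall_apply_single_ne_zero
  set e : Fin n → EuclideanSpace ℝ (Fin n) := fun i => EuclideanSpace.single i 1
  have hsymm (j a) : k.symm (e a) j = k (e j) a := by
    have := k.inner_map_map (e j) (k.symm (e a))
    rw [k.apply_symm_apply] at this
    simpa [e, EuclideanSpace.inner_single_left, EuclideanSpace.inner_single_right] using this.symm
  have h₁ (j a) : lam j * (k (e j) a * k (e j) a) = mu a * k (e j) a := by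
    simpa [e, hsymm, Pi.single_apply] using h (k (e j)) (e a) (e a)
  have h₂ (j a) : lam j * k (e j) a = mu a * (k (e j) a * k (e j) a) := by
    simpa [e, hsymm, Pi.single_apply] using h (k (e j)) (k (e j)) (e a)
  have hsign (j) : ∃ s : ℝ, (s = 1 ∨ s = -1) ∧ lam j * s = mu (σ j) := by
    have hne := hσ j
    have e₁ : lam j * k (e j) (σ j) = mu (σ j) :=
      mul_right_cancel₀ hne (by linear_combination h₁ j (σ j))
    have e₂ : lam j = mu (σ j) * k (e j) (σ j) :=
      mul_right_cancel₀ hne (by linear_combination h₂ j (σ j))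
    by_cases hl : lam j = 0
    · exact ⟨1, Or.inl rfl, by rw [← e₁, hl]; simp⟩
    · refine ⟨k (e j) (σ j), mul_self_eq_one_iff.mp (mul_left_cancel₀ hl ?_), e₁⟩
      linear_combination k (e j) (σ j) * e₁ - e₂
  choose ε hε hlam using hsign
  have hε' (i) : ε i * ε i = 1 := mul_self_eq_one_iff.mpr (hε i)
  refine ⟨signedPermIsometry σ ε hε', σ, ε, hε, signedPermIsometry_single σ ε hε', fun u v w => ?_⟩
  rw [← Equiv.sum_comp σ fun i => mu i * (u i * v i * w i)]
  refine Finset.sum_congr rfl fun i _ => ?_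
  simp only [signedPermIsometry_symm_apply, ← hlam]
  linear_combination lam i * ε i * u (σ i) * v (σ i) * w (σ i) * hε' i
end
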